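/- Let G be a subgraph of a fullerene graph F_n with n ≠ 24. If G contains the pentagonal ring R_6 as a subgraph, then G is not extremal. -/

import Mathlib

namespace FG

/-- A combinatorial plane (spherically embedded) graph: a finite simple graph together with
its collection of faces, each face recorded as the finset of edges of its boundary cycle.
Every face boundary is a cycle, every edge lies on exactly two faces, and Euler's formula
holds (edges are counted via the face incidences). -/
structure PlaneGraph (V : Type) [Fintype V] [DecidableEq V] : Type where
  graph : SimpleGraph V
  faces : Finset (Finset (Sym2 V))
  face_edges : ∀ f ∈ faces, ∀ e ∈ f, e ∈ graph.edgeSet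
  face_cycle : ∀ f ∈ faces, ∃ (v : V) (c : graph.Walk v v), c.IsCycle ∧ c.edges.toFinset = f
  edge_faces : ∀ e ∈ graph.edgeSet, (faces.filter (fun f => e ∈ f)).card = 2
  euler : 2 * (Fintype.card V + faces.card) = (∑ f ∈ faces, f.card) + 4

variable {V : Type} [Fintype V] [DecidableEq V]

/-- The vertices incident with at least one edge of an edge set. -/
def edgeVerts (E : Finset (Sym2 V)) : Finset V :=
  Finset.univ.filter fun v => ∃ e ∈ E, v ∈ e

/-- The degree of a vertex in the subgraph spanned by an edge set. -/
def deg (E : Finset (Sym2 V)) (v : V) : ℕ := (E.filter fun e => v ∈ e).card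

/-- The vertices covered by a collection of faces. -/
def facesVerts (H : Finset (Finset (Sym2 V))) : Finset V := edgeVerts (H.sup id)

/-- An edge set is a matching: non-loop edges, pairwise vertex-disjoint. -/
def IsMatching (M : Finset (Sym2 V)) : Prop :=
  (∀ e ∈ M, ¬e.IsDiag) ∧ ∀ e ∈ M, ∀ e' ∈ M, e ≠ e' → ∀ v : V, v ∈ e → v ∉ e'

/-- A fullerene graph: a cubic 3-connected plane graph with (exactly 12) pentagonal
faces and hexagonal faces. -/
structure IsFullerene (P : PlaneGraph V) : Prop where
  cubic : ∀ v : V, (P.graph.neighborSet v).ncard = 3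
  threeConnected : ∀ s : Set V, s.ncard ≤ 2 → (SimpleGraph.induce sᶜ P.graph).Connected
  faceSize : ∀ f ∈ P.faces, f.card = 5 ∨ f.card = 6
  pentTwelve : (P.faces.filter fun f => f.card = 5).card = 12

/-- A fragment of a plane graph: a nonempty set of faces (a cycle together with its
interior) whose boundary — the set of edges lying on exactly one chosen face — is a
single cycle. -/
structure Fragment (P : PlaneGraph V) : Type where
  inFaces : Finset (Finset (Sym2 V))
  nonempty : inFaces.Nonempty
  subFaces : inFaces ⊆ P.faces
  boundary_cycle : ∃ (v : V) (c : P.graph.Walk v v), c.IsCycle ∧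
    c.edges.toFinset =
      (inFaces.sup id).filter fun e => (inFaces.filter fun f => e ∈ f).card = 1

/-- The edge set of a fragment. -/
def Fragment.edges {P : PlaneGraph V} (B : Fragment P) : Finset (Sym2 V) := B.inFaces.sup id

/-- The boundary edges of a fragment. -/
def Fragment.boundary {P : PlaneGraph V} (B : Fragment P) : Finset (Sym2 V) :=
  B.edges.filter fun e => (B.inFaces.filter fun f => e ∈ f).card = 1

/-- A pentagonal fragment: all inner faces are pentagons. -/
def IsPentagonalFragment {P : PlaneGraph V} (B : Fragment P) : Prop :=
  ∀ f ∈ B.inFaces, f.card = 5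

/-- The faces of `P` adjoining the subgraph with edge set `E`: not a face of the
subgraph, but sharing at least one edge with it. -/
def adjoiningFaces (P : PlaneGraph V) (E : Finset (Sym2 V)) : Finset (Finset (Sym2 V)) :=
  P.faces.filter fun f => ¬f ⊆ E ∧ (f ∩ E).Nonempty

/-- The territory `T[G]` of the subgraph with edge set `E`: the subgraph together with
all adjoining faces. -/
def territoryEdges (P : PlaneGraph V) (E : Finset (Sym2 V)) : Finset (Sym2 V) :=
  E ∪ (adjoiningFaces P E).sup id

/-- `w(G)`: the number of 2-degree vertices of the subgraph spanned by `E`. -/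
def wcount (E : Finset (Sym2 V)) : ℕ := ((edgeVerts E).filter fun v => deg E v = 2).card

/-- A subgraph is maximal in `P` when its hexagon extension is contained in `P`,
i.e. every adjoining face is a hexagon. -/
def IsMaximalIn (P : PlaneGraph V) (E : Finset (Sym2 V)) : Prop :=
  ∀ f ∈ adjoiningFaces P E, f.card = 6

/-- `H ∈ 𝒮(G)` for the subgraph `G` with edge set `E`: `H` is a set of mutually disjoint
hexagons of the hexagon extension `H[G]` (hexagonal faces sharing at least one edge with
`G`) such that `G − H` has a matching covering all remaining 3-degree vertices of `G`. -/
def SextetAdm (P : PlaneGraph V) (E : Finset (Sym2 V)) (H : Finset (Finset (Sym2 V))) : Prop :=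
  (∀ f ∈ H, f ∈ P.faces ∧ f.card = 6 ∧ (f ∩ E).Nonempty) ∧
  (∀ f ∈ H, ∀ g ∈ H, f ≠ g → Disjoint (edgeVerts f) (edgeVerts g)) ∧
  ∃ M : Finset (Sym2 V), M ⊆ E ∧ IsMatching M ∧
    (∀ e ∈ M, ∀ v : V, v ∈ e → v ∉ facesVerts H) ∧
    ∀ v ∈ edgeVerts E, deg E v = 3 → v ∉ facesVerts H → ∃ e ∈ M, v ∈ e

/-- `U_H(G) = V(G) ∖ V(H)`. -/
def Uset (E : Finset (Sym2 V)) (H : Finset (Finset (Sym2 V))) : Finset V :=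
  edgeVerts E \ facesVerts H

/-- A Clar set of `H[G]`: a member of `𝒮(G)` minimizing `|U_H(G)|`. -/
def IsClarSet (P : PlaneGraph V) (E : Finset (Sym2 V)) (H : Finset (Finset (Sym2 V))) : Prop :=
  SextetAdm P E H ∧ ∀ H', SextetAdm P E H' → (Uset E H).card ≤ (Uset E H').card

/-- A normal Clar set: a Clar set such that `G − H` has a perfect matching. -/
def IsNormalClarSet (P : PlaneGraph V) (E : Finset (Sym2 V))
    (H : Finset (Finset (Sym2 V))) : Prop :=
  IsClarSet P E H ∧ ∃ M : Finset (Sym2 V), M ⊆ E ∧ IsMatching M ∧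
    (∀ e ∈ M, ∀ v : V, v ∈ e → v ∉ facesVerts H) ∧
    ∀ v ∈ Uset E H, ∃ e ∈ M, v ∈ e

/-- The pentagonal faces of the subgraph with edge set `E`. -/
def pentFaces (P : PlaneGraph V) (E : Finset (Sym2 V)) : Finset (Finset (Sym2 V)) :=
  P.faces.filter fun f => f.card = 5 ∧ f ⊆ E

/-- A subgraph with `k` pentagons is extremal if `|U_H(G)| = k` for a Clar set `H`. -/
def IsExtremalSub (P : PlaneGraph V) (E : Finset (Sym2 V)) : Prop :=
  ∃ H, IsClarSet P E H ∧ (Uset E H).card = (pentFaces P E).card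

/-- A pentagonal ring `R_k`: `k` pentagonal faces `R 0, …, R (k-1)` such that
`R i` and `R j` intersect iff `|i − j| = 1 (mod k)`. -/
def IsPentRing (P : PlaneGraph V) (k : ℕ) (R : ZMod k → Finset (Sym2 V)) : Prop :=
  Function.Injective R ∧ (∀ i, R i ∈ P.faces ∧ (R i).card = 5) ∧
  ∀ i j : ZMod k, i ≠ j →
    ((edgeVerts (R i) ∩ edgeVerts (R j)).Nonempty ↔ (j = i + 1 ∨ i = j + 1))

/-- The number of pentagons of the pentagonal fragment `B` adjoining (sharing an edge
with) the pentagon `p`. -/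
def pentAdjCount {P : PlaneGraph V} (B : Fragment P) (p : Finset (Sym2 V)) : ℕ :=
  (B.inFaces.filter fun q => q ≠ p ∧ (q ∩ p).Nonempty).card

/-- The fragment consisting of a single pentagon `P`. -/
def IsPentagonFrag {P : PlaneGraph V} (B : Fragment P) : Prop :=
  IsPentagonalFragment B ∧ B.inFaces.card = 1

/-- `B_2`: the extremal pentagonal fragment with 4 pentagons whose Clar extension is
normal. -/
def IsB2Frag {P : PlaneGraph V} (B : Fragment P) : Prop :=
  IsPentagonalFragment B ∧ B.inFaces.card = 4 ∧ IsExtremalSub P B.edges ∧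
    ∃ H, IsNormalClarSet P B.edges H

/-- `B_3`: the extremal pentagonal fragment with 6 pentagons whose Clar extension is
normal. -/
def IsB3Frag {P : PlaneGraph V} (B : Fragment P) : Prop :=
  IsPentagonalFragment B ∧ B.inFaces.card = 6 ∧ IsExtremalSub P B.edges ∧
    ∃ H, IsNormalClarSet P B.edges H

/-- A pasting edge of the subgraph with edge set `E`: an edge of `E` lying on the
boundary of the Clar extension `C[G]` (not an edge of a Clar hexagon) whose two
end-vertices belong to `V(H)` for a Clar set `H`. -/
def IsPastingEdge (P : PlaneGraph V) (E : Finset (Sym2 V)) (e : Sym2 V) : Prop :=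
  e ∈ E ∧ ∃ H, IsClarSet P E H ∧ (∀ v : V, v ∈ e → v ∈ facesVerts H) ∧ e ∉ H.sup id

/-- `B` arises from pasting `A` and `C` along a common pasting edge:
`B = A ∪ C` and `A ∩ C` is a single pasting edge of both. -/
def IsPasting {P : PlaneGraph V} (B A C : Fragment P) : Prop :=
  B.inFaces = A.inFaces ∪ C.inFaces ∧
  ∃ e : Sym2 V, A.edges ∩ C.edges = {e} ∧ IsPastingEdge P A.edges e ∧ IsPastingEdge P C.edges e

def IsBasicFrag {P : PlaneGraph V} (B : Fragment P) : Prop :=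
  IsPentagonFrag B ∨ IsB2Frag B ∨ IsB3Frag B

/-- The pentagonal fragments generated from `P`, `B_2`, `B_3` by the pasting operation. -/
inductive Pasted (P : PlaneGraph V) : Fragment P → Prop
  | base (B : Fragment P) : IsBasicFrag B → Pasted P B
  | paste (B A C : Fragment P) : Pasted P A → IsBasicFrag C → IsPasting B A C → Pasted P B

/-- `P ∗ P`. -/
def IsPPFrag {P : PlaneGraph V} (B : Fragment P) : Prop :=
  ∃ A C : Fragment P, IsPentagonFrag A ∧ IsPentagonFrag C ∧ IsPasting B A C

/-- `P ∗ B_2`. -/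
def IsPB2Frag {P : PlaneGraph V} (B : Fragment P) : Prop :=
  ∃ A C : Fragment P, IsPentagonFrag A ∧ IsB2Frag C ∧ IsPasting B A C

/-- `P ∗ B_2 ∗ P`. -/
def IsPB2PFrag {P : PlaneGraph V} (B : Fragment P) : Prop :=
  ∃ B' A C D : Fragment P, IsPentagonFrag A ∧ IsB2Frag C ∧ IsPentagonFrag D ∧
    IsPasting B' A C ∧ IsPasting B B' D

/-- The six members of `𝓑_{≥60}`. -/
def SixShapes {P : PlaneGraph V} (B : Fragment P) : Prop :=
  IsPentagonFrag B ∨ IsB2Frag B ∨ IsB3Frag B ∨ IsPPFrag B ∨ IsPB2Frag B ∨ IsPB2PFrag B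

/-- `B_1`: two vertex-disjoint pentagons joined by an edge. -/
def IsB1 (P : PlaneGraph V) (E : Finset (Sym2 V)) : Prop :=
  ∃ (f g : Finset (Sym2 V)) (a b : V), f ∈ P.faces ∧ g ∈ P.faces ∧ f.card = 5 ∧ g.card = 5 ∧
    Disjoint (edgeVerts f) (edgeVerts g) ∧ P.graph.Adj a b ∧
    a ∈ edgeVerts f ∧ b ∈ edgeVerts g ∧ E = f ∪ g ∪ {s(a, b)}

/-- `B_1^k`: `k` copies of `B_1` pasted together along pasting edges of their pentagons. -/
inductive B1Pow (P : PlaneGraph V) : ℕ → Finset (Sym2 V) → Prop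
  | one (E : Finset (Sym2 V)) : IsB1 P E → B1Pow P 1 E
  | succ (k : ℕ) (E X : Finset (Sym2 V)) (e : Sym2 V) (f g : Finset (Sym2 V)) :
      B1Pow P k E → IsB1 P X → E ∩ X = {e} → f ∈ P.faces → g ∈ P.faces →
      f.card = 5 → g.card = 5 → f ⊆ E → g ⊆ X → e ∈ f → e ∈ g →
      IsPastingEdge P f e → IsPastingEdge P g e → B1Pow P (k + 1) (E ∪ X)

/-- `F` contains `B_1^k` for some `2 ≤ k ≤ 4` as a subgraph. -/
def ContainsB1Pow (P : PlaneGraph V) : Prop :=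
  ∃ (k : ℕ) (E : Finset (Sym2 V)), 2 ≤ k ∧ k ≤ 4 ∧ B1Pow P k E

/-- A perfect matching of the plane graph `P`. -/
def IsPerfectMatching (P : PlaneGraph V) (M : Finset (Sym2 V)) : Prop :=
  (∀ e ∈ M, e ∈ P.graph.edgeSet) ∧ IsMatching M ∧ ∀ v : V, ∃ e ∈ M, v ∈ e

/-- A sextet pattern of `P`: mutually disjoint hexagonal faces, all alternating with
respect to a common perfect matching. -/
def IsSextetPattern (P : PlaneGraph V) (H : Finset (Finset (Sym2 V))) : Prop :=
  (∀ f ∈ H, f ∈ P.faces ∧ f.card = 6) ∧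
  (∀ f ∈ H, ∀ g ∈ H, f ≠ g → Disjoint (edgeVerts f) (edgeVerts g)) ∧
  ∃ M : Finset (Sym2 V), IsPerfectMatching P M ∧ ∀ f ∈ H, (f ∩ M).card = 3

/-- A Clar formula: a maximum sextet pattern. -/
def IsClarFormula (P : PlaneGraph V) (H : Finset (Finset (Sym2 V))) : Prop :=
  IsSextetPattern P H ∧ ∀ H', IsSextetPattern P H' → H'.card ≤ H.card

/-- An extremal fullerene graph: the Clar number equals `(n − 12)/6`. -/
def IsExtremalFullerene (P : PlaneGraph V) : Prop :=
  ∃ H, IsClarFormula P H ∧ 6 * H.card = Fintype.card V - 12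

/-- The edges of the union of all maximal pentagonal fragments of `P`. -/
noncomputable def maxPentEdges (P : PlaneGraph V) : Finset (Sym2 V) :=
  @Finset.filter _
    (fun e => ∃ B : Fragment P, IsPentagonalFragment B ∧ IsMaximalIn P B.edges ∧ e ∈ B.edges)
    (Classical.decPred _) (P.faces.sup id)

/-- The disjoint union of two copies of `K_2`. -/
def twoK2 : SimpleGraph (Fin 4) := SimpleGraph.fromEdgeSet {s(0, 1), s(2, 3)}

/-- The tree `T_0` on six vertices: two adjacent 3-degree vertices, each also adjacent
to two leaves. -/
def treeT0 : SimpleGraph (Fin 6) :=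
  SimpleGraph.fromEdgeSet {s(0, 1), s(0, 2), s(0, 3), s(1, 4), s(1, 5)}


set_option linter.unusedSectionVars false

/-! ### Basic facts on faces -/

/-- `f` is the 5-cycle `u v w x y`. -/
def Cyc5 (f : Finset (Sym2 V)) (u v w x y : V) : Prop :=
  (u ≠ v ∧ u ≠ w ∧ u ≠ x ∧ u ≠ y ∧ v ≠ w ∧ v ≠ x ∧ v ≠ y ∧ w ≠ x ∧ w ≠ y ∧ x ≠ y) ∧
  f = {s(u, v), s(v, w), s(w, x), s(x, y), s(y, u)}

/-- `f` is the 6-cycle `u v w x y z`. -/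
def Cyc6 (f : Finset (Sym2 V)) (u v w x y z : V) : Prop :=
  (u ≠ v ∧ u ≠ w ∧ u ≠ x ∧ u ≠ y ∧ u ≠ z ∧ v ≠ w ∧ v ≠ x ∧ v ≠ y ∧ v ≠ z ∧ w ≠ x ∧ w ≠ y ∧
    w ≠ z ∧ x ≠ y ∧ x ≠ z ∧ y ≠ z) ∧
  f = {s(u, v), s(v, w), s(w, x), s(x, y), s(y, z), s(z, u)}

lemma Cyc5.rot {f : Finset (Sym2 V)} {u v w x y : V} (h : Cyc5 f u v w x y) :
    Cyc5 f v w x y u := by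
  obtain ⟨h1, h2⟩ := h
  refine ⟨by tauto, ?_⟩
  rw [h2]; ext e; simp only [Finset.mem_insert, Finset.mem_singleton]; tauto

lemma Cyc6.rot {f : Finset (Sym2 V)} {u v w x y z : V} (h : Cyc6 f u v w x y z) :
    Cyc6 f v w x y z u := by
  obtain ⟨h1, h2⟩ := h
  refine ⟨by tauto, ?_⟩
  rw [h2]; ext e; simp only [Finset.mem_insert, Finset.mem_singleton]; tauto

lemma Cyc5.refl {f : Finset (Sym2 V)} {u v w x y : V} (h : Cyc5 f u v w x y) :
    Cyc5 f v u y x w := by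
  obtain ⟨h1, h2⟩ := h
  refine ⟨by tauto, ?_⟩
  rw [h2]; ext e
  simp only [Finset.mem_insert, Finset.mem_singleton, Sym2.eq_swap (a := v) (b := u),
    Sym2.eq_swap (a := u) (b := y), Sym2.eq_swap (a := y) (b := x), Sym2.eq_swap (a := x) (b := w),
    Sym2.eq_swap (a := w) (b := v)]
  tauto

lemma Cyc6.refl {f : Finset (Sym2 V)} {u v w x y z : V} (h : Cyc6 f u v w x y z) :
    Cyc6 f v u z y x w := by
  obtain ⟨h1, h2⟩ := h
  refine ⟨by tauto, ?_⟩
  rw [h2]; ext e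
  simp only [Finset.mem_insert, Finset.mem_singleton, Sym2.eq_swap (a := v) (b := u),
    Sym2.eq_swap (a := u) (b := z), Sym2.eq_swap (a := z) (b := y), Sym2.eq_swap (a := y) (b := x),
    Sym2.eq_swap (a := x) (b := w), Sym2.eq_swap (a := w) (b := v)]
  tauto

lemma Cyc5.mem {f : Finset (Sym2 V)} {u v w x y : V} (h : Cyc5 f u v w x y) (p q : V) :
    s(p, q) ∈ f ↔ (p = u ∧ q = v) ∨ (p = v ∧ q = u) ∨ (p = v ∧ q = w) ∨ (p = w ∧ q = v) ∨
      (p = w ∧ q = x) ∨ (p = x ∧ q = w) ∨ (p = x ∧ q = y) ∨ (p = y ∧ q = x) ∨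
      (p = y ∧ q = u) ∨ (p = u ∧ q = y) := by
  rw [h.2]; simp only [Finset.mem_insert, Finset.mem_singleton, Sym2.eq_iff, or_assoc]

lemma Cyc6.mem {f : Finset (Sym2 V)} {u v w x y z : V} (h : Cyc6 f u v w x y z) (p q : V) :
    s(p, q) ∈ f ↔ (p = u ∧ q = v) ∨ (p = v ∧ q = u) ∨ (p = v ∧ q = w) ∨ (p = w ∧ q = v) ∨
      (p = w ∧ q = x) ∨ (p = x ∧ q = w) ∨ (p = x ∧ q = y) ∨ (p = y ∧ q = x) ∨
      (p = y ∧ q = z) ∨ (p = z ∧ q = y) ∨ (p = z ∧ q = u) ∨ (p = u ∧ q = z) := by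
  rw [h.2]; simp only [Finset.mem_insert, Finset.mem_singleton, Sym2.eq_iff, or_assoc]

lemma mem_edgeVerts {f : Finset (Sym2 V)} {p : V} : p ∈ edgeVerts f ↔ ∃ q, s(p, q) ∈ f := by
  unfold edgeVerts
  simp only [Finset.mem_filter, Finset.mem_univ, true_and]
  constructor
  · rintro ⟨e, he, hp⟩
    obtain ⟨q, rfl⟩ := hp
    exact ⟨q, he⟩
  · rintro ⟨q, hq⟩
    exact ⟨_, hq, Sym2.mem_mk_left p q⟩

lemma Cyc5.verts {f : Finset (Sym2 V)} {u v w x y : V} (h : Cyc5 f u v w x y) (p : V) :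
    p ∈ edgeVerts f ↔ p = u ∨ p = v ∨ p = w ∨ p = x ∨ p = y := by
  rw [mem_edgeVerts]
  simp only [h.mem]
  constructor
  · rintro ⟨q, hq⟩; grind
  · rintro (rfl | rfl | rfl | rfl | rfl)
    · exact ⟨v, by simp⟩
    · exact ⟨w, by simp⟩
    · exact ⟨x, by simp⟩
    · exact ⟨y, by simp⟩
    · exact ⟨u, by simp⟩

lemma Cyc6.verts {f : Finset (Sym2 V)} {u v w x y z : V} (h : Cyc6 f u v w x y z) (p : V) :
    p ∈ edgeVerts f ↔ p = u ∨ p = v ∨ p = w ∨ p = x ∨ p = y ∨ p = z := by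
  rw [mem_edgeVerts]
  simp only [h.mem]
  constructor
  · rintro ⟨q, hq⟩; grind
  · rintro (rfl | rfl | rfl | rfl | rfl | rfl)
    · exact ⟨v, by simp⟩
    · exact ⟨w, by simp⟩
    · exact ⟨x, by simp⟩
    · exact ⟨y, by simp⟩
    · exact ⟨z, by simp⟩
    · exact ⟨u, by simp⟩

lemma cycle_length {P : PlaneGraph V} {v : V} {c : P.graph.Walk v v} (hc : c.IsCycle) :
    c.edges.toFinset.card = c.length := by
  rw [List.toFinset_card_of_nodup hc.isTrail.edges_nodup, SimpleGraph.Walk.length_edges]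

lemma face5 {P : PlaneGraph V} {f : Finset (Sym2 V)} (hf : f ∈ P.faces) (h5 : f.card = 5) :
    ∃ u v w x y, Cyc5 f u v w x y := by
  obtain ⟨v, c, hc, rfl⟩ := P.face_cycle f hf
  rw [cycle_length hc] at h5
  have hnd := hc.support_nodup
  match c, h5 with
  | .cons h1 (.cons h2 (.cons h3 (.cons h4 (.cons h5 .nil)))), _ =>
    rename_i a b c d _
    refine ⟨v, a, b, c, d, ?_, ?_⟩
    · simp [SimpleGraph.Walk.support] at hnd
      grind
    · simp [SimpleGraph.Walk.edges]
  
lemma face6 {P : PlaneGraph V} {f : Finset (Sym2 V)} (hf : f ∈ P.faces) (h6 : f.card = 6) :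
    ∃ u v w x y z, Cyc6 f u v w x y z := by
  obtain ⟨v, c, hc, rfl⟩ := P.face_cycle f hf
  rw [cycle_length hc] at h6
  have hnd := hc.support_nodup
  match c, h6 with
  | .cons h1 (.cons h2 (.cons h3 (.cons h4 (.cons h5 (.cons h6 .nil))))), _ =>
    rename_i a b c d e _
    refine ⟨v, a, b, c, d, e, ?_, ?_⟩
    · simp [SimpleGraph.Walk.support] at hnd
      grind
    · simp [SimpleGraph.Walk.edges]

lemma cyc5_edge {f : Finset (Sym2 V)} {u v w x y : V} (h : Cyc5 f u v w x y) {p q : V}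
    (hpq : s(p, q) ∈ f) : ∃ w x y, Cyc5 f p q w x y := by
  rw [h.mem] at hpq
  rcases hpq with ⟨rfl, rfl⟩ | ⟨rfl, rfl⟩ | ⟨rfl, rfl⟩ | ⟨rfl, rfl⟩ | ⟨rfl, rfl⟩ | ⟨rfl, rfl⟩ |
    ⟨rfl, rfl⟩ | ⟨rfl, rfl⟩ | ⟨rfl, rfl⟩ | ⟨rfl, rfl⟩
  · exact ⟨_, _, _, h⟩
  · exact ⟨_, _, _, h.refl⟩
  · exact ⟨_, _, _, h.rot⟩
  · exact ⟨_, _, _, h.rot.refl⟩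
  · exact ⟨_, _, _, h.rot.rot⟩
  · exact ⟨_, _, _, h.rot.rot.refl⟩
  · exact ⟨_, _, _, h.rot.rot.rot⟩
  · exact ⟨_, _, _, h.rot.rot.rot.refl⟩
  · exact ⟨_, _, _, h.rot.rot.rot.rot⟩
  · exact ⟨_, _, _, h.rot.rot.rot.rot.refl⟩

lemma cyc6_edge {f : Finset (Sym2 V)} {u v w x y z : V} (h : Cyc6 f u v w x y z) {p q : V}
    (hpq : s(p, q) ∈ f) : ∃ w x y z, Cyc6 f p q w x y z := by
  rw [h.mem] at hpq
  rcases hpq with ⟨rfl, rfl⟩ | ⟨rfl, rfl⟩ | ⟨rfl, rfl⟩ | ⟨rfl, rfl⟩ | ⟨rfl, rfl⟩ | ⟨rfl, rfl⟩ |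
    ⟨rfl, rfl⟩ | ⟨rfl, rfl⟩ | ⟨rfl, rfl⟩ | ⟨rfl, rfl⟩ | ⟨rfl, rfl⟩ | ⟨rfl, rfl⟩
  · exact ⟨_, _, _, _, h⟩
  · exact ⟨_, _, _, _, h.refl⟩
  · exact ⟨_, _, _, _, h.rot⟩
  · exact ⟨_, _, _, _, h.rot.refl⟩
  · exact ⟨_, _, _, _, h.rot.rot⟩
  · exact ⟨_, _, _, _, h.rot.rot.refl⟩
  · exact ⟨_, _, _, _, h.rot.rot.rot⟩
  · exact ⟨_, _, _, _, h.rot.rot.rot.refl⟩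
  · exact ⟨_, _, _, _, h.rot.rot.rot.rot⟩
  · exact ⟨_, _, _, _, h.rot.rot.rot.rot.refl⟩
  · exact ⟨_, _, _, _, h.rot.rot.rot.rot.rot⟩
  · exact ⟨_, _, _, _, h.rot.rot.rot.rot.rot.refl⟩

/-- A face through the edge `pq` is a 5- or 6-cycle starting with `p q`. -/
lemma face_edge {P : PlaneGraph V} (hP : IsFullerene P) {f : Finset (Sym2 V)} (hf : f ∈ P.faces)
    {p q : V} (hpq : s(p, q) ∈ f) :
    (f.card = 5 ∧ ∃ w x y, Cyc5 f p q w x y) ∨ (f.card = 6 ∧ ∃ w x y z, Cyc6 f p q w x y z) := by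
  rcases hP.faceSize f hf with h | h
  · obtain ⟨u, v, w, x, y, hc⟩ := face5 hf h
    exact Or.inl ⟨h, cyc5_edge hc hpq⟩
  · obtain ⟨u, v, w, x, y, z, hc⟩ := face6 hf h
    exact Or.inr ⟨h, cyc6_edge hc hpq⟩

lemma face_adj {P : PlaneGraph V} {f : Finset (Sym2 V)} (hf : f ∈ P.faces)
    {p q : V} (hpq : s(p, q) ∈ f) : P.graph.Adj p q := by
  simpa using P.face_edges f hf _ hpq

/-- Every vertex of a face has exactly two face-neighbours. -/
lemma face_deg {P : PlaneGraph V} (hP : IsFullerene P) {f : Finset (Sym2 V)} (hf : f ∈ P.faces)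
    {p q : V} (hpq : s(p, q) ∈ f) : ∃ r, r ≠ q ∧ ∀ t, s(p, t) ∈ f ↔ t = q ∨ t = r := by
  rcases face_edge hP hf hpq with ⟨_, w, x, y, h⟩ | ⟨_, w, x, y, z, h⟩
  · have h1 := h.1
    refine ⟨y, by tauto, fun t => ?_⟩
    rw [h.mem]
    constructor
    · intro h'; grind
    · intro h'; grind
  · have h1 := h.1
    refine ⟨z, by tauto, fun t => ?_⟩
    rw [h.mem]
    constructor
    · intro h'; grind
    · intro h'; grind

/-- `v` has exactly the three neighbours `p q r`. -/
def Nb (P : PlaneGraph V) (v p q r : V) : Prop :=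
  p ≠ q ∧ p ≠ r ∧ q ≠ r ∧ ∀ t, P.graph.Adj v t ↔ t = p ∨ t = q ∨ t = r

lemma exists_nb {P : PlaneGraph V} (hP : IsFullerene P) (v : V) : ∃ p q r, Nb P v p q r := by
  obtain ⟨p, q, r, h1, h2, h3, h⟩ := Set.ncard_eq_three.1 (hP.cubic v)
  refine ⟨p, q, r, h1, h2, h3, fun t => ?_⟩
  rw [← SimpleGraph.mem_neighborSet, h]; simp

lemma nb_of {P : PlaneGraph V} (hP : IsFullerene P) {v p q r : V} (h1 : P.graph.Adj v p)
    (h2 : P.graph.Adj v q) (h3 : P.graph.Adj v r) (hpq : p ≠ q) (hpr : p ≠ r) (hqr : q ≠ r) :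
    Nb P v p q r := by
  obtain ⟨a, b, c, hab, hac, hbc, h⟩ := exists_nb hP v
  refine ⟨hpq, hpr, hqr, fun t => ?_⟩
  have := (h p).1 h1
  have := (h q).1 h2
  have := (h r).1 h3
  rw [h]
  grind

lemma exists_third {P : PlaneGraph V} (hP : IsFullerene P) {v p q : V} (h1 : P.graph.Adj v p)
    (h2 : P.graph.Adj v q) (hpq : p ≠ q) : ∃ r, Nb P v p q r := by
  obtain ⟨a, b, c, hab, hac, hbc, h⟩ := exists_nb hP v
  have k1 := (h p).1 h1
  have k2 := (h q).1 h2
  have : ∃ r, P.graph.Adj v r ∧ r ≠ p ∧ r ≠ q := by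
    by_contra hcon
    push Not at hcon
    have ha := hcon a ((h a).2 (by tauto))
    have hb := hcon b ((h b).2 (by tauto))
    have hc := hcon c ((h c).2 (by tauto))
    grind
  obtain ⟨r, h3, h4, h5⟩ := this
  exact ⟨r, nb_of hP h1 h2 h3 hpq h4.symm h5.symm⟩

lemma two_faces {P : PlaneGraph V} {p q : V} (h : P.graph.Adj p q) :
    ∃ f g, f ∈ P.faces ∧ g ∈ P.faces ∧ f ≠ g ∧ s(p, q) ∈ f ∧ s(p, q) ∈ g ∧
      ∀ k ∈ P.faces, s(p, q) ∈ k → k = f ∨ k = g := by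
  have := P.edge_faces s(p, q) (by simpa using h)
  obtain ⟨f, g, hne, hfg⟩ := Finset.card_eq_two.1 this
  have hf : f ∈ P.faces.filter (fun f => s(p, q) ∈ f) := by rw [hfg]; simp
  have hg : g ∈ P.faces.filter (fun f => s(p, q) ∈ f) := by rw [hfg]; simp
  rw [Finset.mem_filter] at hf hg
  refine ⟨f, g, hf.1, hg.1, hne, hf.2, hg.2, fun k hk hk' => ?_⟩
  have : k ∈ P.faces.filter (fun f => s(p, q) ∈ f) := Finset.mem_filter.2 ⟨hk, hk'⟩
  rw [hfg] at this
  simpa using this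

/-- No three distinct faces share an edge. -/
lemma no_three {P : PlaneGraph V} {f g k : Finset (Sym2 V)} {p q : V} (hf : f ∈ P.faces)
    (hg : g ∈ P.faces) (hk : k ∈ P.faces) (h1 : s(p, q) ∈ f) (h2 : s(p, q) ∈ g)
    (h3 : s(p, q) ∈ k) : f = g ∨ f = k ∨ g = k := by
  obtain ⟨a, b, _, _, _, _, _, h⟩ := two_faces (face_adj hf h1)
  have := h f hf h1
  have := h g hg h2
  have := h k hk h3
  grind

lemma no_all {P : PlaneGraph V} (hP : IsFullerene P) {f : Finset (Sym2 V)} (hf : f ∈ P.faces)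
    {v p q r : V} (h1 : s(v, p) ∈ f) (h2 : s(v, q) ∈ f) (h3 : s(v, r) ∈ f) :
    p = q ∨ p = r ∨ q = r := by
  obtain ⟨t, _, h⟩ := face_deg hP hf h1
  have := (h q).1 h2
  have := (h r).1 h3
  grind

/-- A face containing `vp` contains one of the two other edges at `v`. -/
lemma face_other {P : PlaneGraph V} (hP : IsFullerene P) {f : Finset (Sym2 V)} (hf : f ∈ P.faces)
    {v p q r : V} (hN : Nb P v p q r) (h1 : s(v, p) ∈ f) : s(v, q) ∈ f ∨ s(v, r) ∈ f := by
  obtain ⟨t, ht, h⟩ := face_deg hP hf h1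
  have h2 : s(v, t) ∈ f := (h t).2 (Or.inr rfl)
  rcases (hN.2.2.2 t).1 (face_adj hf h2) with rfl | rfl | rfl <;> tauto

/-- Two distinct edges at a vertex lie in at most one common face. -/
lemma corner_unique {P : PlaneGraph V} (hP : IsFullerene P) {f g : Finset (Sym2 V)}
    (hf : f ∈ P.faces) (hg : g ∈ P.faces) {v p q : V} (hpq : p ≠ q) (h1 : s(v, p) ∈ f)
    (h2 : s(v, q) ∈ f) (h3 : s(v, p) ∈ g) (h4 : s(v, q) ∈ g) : f = g := by
  by_contra hne
  obtain ⟨r, hN⟩ := exists_third hP (face_adj hf h1) (face_adj hf h2) hpq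
  have hadj : P.graph.Adj v r := (hN.2.2.2 r).2 (by tauto)
  obtain ⟨k, l, hk, hl, hkl, hk', hl', _⟩ := two_faces hadj
  have hN' : Nb P v r p q := by
    obtain ⟨a, b, c, d⟩ := hN
    exact ⟨b.symm, c.symm, a, fun t => by rw [d]; tauto⟩
  have e1 := face_other hP hk hN' hk'
  obtain ⟨a, b, c, d⟩ := hN
  have e2 : k ≠ f := by
    rintro rfl
    have := no_all hP hf h1 h2 hk'
    tauto
  have e3 : k ≠ g := by
    rintro rfl
    have := no_all hP hg h3 h4 hk'
    tauto
  rcases e1 with e | e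
  · have := no_three hf hg hk h1 h3 e; grind
  · have := no_three hf hg hk h2 h4 e; grind

lemma corner_exists {P : PlaneGraph V} (hP : IsFullerene P) {v p q : V} (h1 : P.graph.Adj v p)
    (h2 : P.graph.Adj v q) (hpq : p ≠ q) : ∃ f ∈ P.faces, s(v, p) ∈ f ∧ s(v, q) ∈ f := by
  obtain ⟨r, hN⟩ := exists_third hP h1 h2 hpq
  obtain ⟨f, g, hf, hg, hfg, hf', hg', _⟩ := two_faces h1
  rcases face_other hP hf hN hf' with h | h
  · exact ⟨f, hf, hf', h⟩
  · rcases face_other hP hg hN hg' with h' | h'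
    · exact ⟨g, hg, hg', h'⟩
    · exact absurd (corner_unique hP hf hg hN.2.1 hf' h hg' h') hfg

lemma nb_swap {P : PlaneGraph V} {v p q r : V} (h : Nb P v p q r) : Nb P v p r q := by
  obtain ⟨a, b, c, d⟩ := h
  exact ⟨b, a, c.symm, fun t => by rw [d]; tauto⟩

lemma nb_rot {P : PlaneGraph V} {v p q r : V} (h : Nb P v p q r) : Nb P v q r p := by
  obtain ⟨a, b, c, d⟩ := h
  exact ⟨c, a.symm, b.symm, fun t => by rw [d]; tauto⟩

/-- Walking along an edge shared by two faces: they leave in different directions. -/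
lemma face_step {P : PlaneGraph V} (hP : IsFullerene P) {f g : Finset (Sym2 V)} (hf : f ∈ P.faces)
    (hg : g ∈ P.faces) (hfg : f ≠ g) {v u p q : V} (hN : Nb P v u p q) (h1 : s(v, u) ∈ f)
    (h2 : s(v, u) ∈ g) (h3 : s(v, p) ∈ g) : s(v, q) ∈ f := by
  rcases face_other hP hf hN h1 with h | h
  · exact absurd (corner_unique hP hf hg hN.1 h1 h h2 h3) hfg
  · exact h

/-- Two distinct faces sharing a vertex share an edge at this vertex. -/
lemma share_edge {P : PlaneGraph V} (hP : IsFullerene P) {f g : Finset (Sym2 V)} (hf : f ∈ P.faces)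
    (hg : g ∈ P.faces) {v : V} (h1 : v ∈ edgeVerts f) (h2 : v ∈ edgeVerts g) :
    ∃ w, s(v, w) ∈ f ∧ s(v, w) ∈ g := by
  rw [mem_edgeVerts] at h1 h2
  obtain ⟨p, hp⟩ := h1
  obtain ⟨q, hq⟩ := h2
  by_cases hpq : p = q
  · subst hpq; exact ⟨p, hp, hq⟩
  obtain ⟨r, hN⟩ := exists_third hP (face_adj hf hp) (face_adj hg hq) hpq
  rcases face_other hP hf hN hp with h | h
  · exact ⟨q, h, hq⟩
  · rcases face_other hP hg (nb_rot hN) hq with h' | h'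
    · exact ⟨r, h, h'⟩
    · exact ⟨p, hp, h'⟩

/-- Three distinct faces at `v` are all the faces at `v`. -/
lemma three_faces {P : PlaneGraph V} (hP : IsFullerene P) {f g k l : Finset (Sym2 V)} {v : V}
    (hf : f ∈ P.faces) (hg : g ∈ P.faces) (hk : k ∈ P.faces) (hl : l ∈ P.faces)
    (hfg : f ≠ g) (hfk : f ≠ k) (hgk : g ≠ k)
    (h1 : v ∈ edgeVerts f) (h2 : v ∈ edgeVerts g) (h3 : v ∈ edgeVerts k) (h4 : v ∈ edgeVerts l) :
    l = f ∨ l = g ∨ l = k := by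
  obtain ⟨p, q, r, hN⟩ := exists_nb hP v
  have key : ∀ l ∈ P.faces, v ∈ edgeVerts l → (s(v, p) ∈ l ∧ s(v, q) ∈ l) ∨
      (s(v, q) ∈ l ∧ s(v, r) ∈ l) ∨ (s(v, r) ∈ l ∧ s(v, p) ∈ l) := by
    intro l hl h
    rw [mem_edgeVerts] at h
    obtain ⟨t, ht⟩ := h
    rcases (hN.2.2.2 t).1 (face_adj hl ht) with rfl | rfl | rfl
    · have := face_other hP hl hN ht; tauto
    · have := face_other hP hl (nb_rot hN) ht; tauto
    · have := face_other hP hl (nb_rot (nb_rot hN)) ht; tauto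
  have c1 := fun (f g : Finset (Sym2 V)) (hf : f ∈ P.faces) (hg : g ∈ P.faces) =>
    corner_unique hP hf hg (v := v) hN.1
  have c2 := fun (f g : Finset (Sym2 V)) (hf : f ∈ P.faces) (hg : g ∈ P.faces) =>
    corner_unique hP hf hg (v := v) hN.2.2.1
  have c3 := fun (f g : Finset (Sym2 V)) (hf : f ∈ P.faces) (hg : g ∈ P.faces) =>
    corner_unique hP hf hg (v := v) hN.2.1.symm
  have kf := key f hf h1
  have kg := key g hg h2
  have kk := key k hk h3
  have kl := key l hl h4
  rcases kl with ⟨x, y⟩ | ⟨x, y⟩ | ⟨x, y⟩ <;> rcases kf with ⟨x1, y1⟩ | ⟨x1, y1⟩ | ⟨x1, y1⟩ <;>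
    rcases kg with ⟨x2, y2⟩ | ⟨x2, y2⟩ | ⟨x2, y2⟩ <;>
    rcases kk with ⟨x3, y3⟩ | ⟨x3, y3⟩ | ⟨x3, y3⟩ <;>
    first
    | exact Or.inl (c1 _ _ hl hf x y x1 y1)
    | exact Or.inl (c2 _ _ hl hf x y x1 y1)
    | exact Or.inl (c3 _ _ hl hf x y x1 y1)
    | exact Or.inr (Or.inl (c1 _ _ hl hg x y x2 y2))
    | exact Or.inr (Or.inl (c2 _ _ hl hg x y x2 y2))
    | exact Or.inr (Or.inl (c3 _ _ hl hg x y x2 y2))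
    | exact Or.inr (Or.inr (c1 _ _ hl hk x y x3 y3))
    | exact Or.inr (Or.inr (c2 _ _ hl hk x y x3 y3))
    | exact Or.inr (Or.inr (c3 _ _ hl hk x y x3 y3))
    | exact absurd (c1 _ _ hf hg x1 y1 x2 y2) hfg
    | exact absurd (c2 _ _ hf hg x1 y1 x2 y2) hfg
    | exact absurd (c3 _ _ hf hg x1 y1 x2 y2) hfg
    | exact absurd (c1 _ _ hf hk x1 y1 x3 y3) hfk
    | exact absurd (c2 _ _ hf hk x1 y1 x3 y3) hfk
    | exact absurd (c3 _ _ hf hk x1 y1 x3 y3) hfk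
    | exact absurd (c1 _ _ hg hk x2 y2 x3 y3) hgk
    | exact absurd (c2 _ _ hg hk x2 y2 x3 y3) hgk
    | exact absurd (c3 _ _ hg hk x2 y2 x3 y3) hgk

/-! ### Faces containing a given path -/

lemma path3 {P : PlaneGraph V} (hP : IsFullerene P) {f : Finset (Sym2 V)} (hf : f ∈ P.faces)
    {a b c : V} (h1 : s(a, b) ∈ f) (h2 : s(b, c) ∈ f) (hac : a ≠ c) :
    (f.card = 5 ∧ ∃ x y, Cyc5 f a b c x y) ∨ (f.card = 6 ∧ ∃ x y z, Cyc6 f a b c x y z) := by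
  rcases face_edge hP hf h1 with ⟨hc, w, x, y, h⟩ | ⟨hc, w, x, y, z, h⟩
  · refine Or.inl ⟨hc, x, y, ?_⟩
    have : c = w := by have h1 := h.1; rw [h.mem] at h2; grind
    subst this; exact h
  · refine Or.inr ⟨hc, x, y, z, ?_⟩
    have : c = w := by have h1 := h.1; rw [h.mem] at h2; grind
    subst this; exact h

lemma path4 {P : PlaneGraph V} (hP : IsFullerene P) {f : Finset (Sym2 V)} (hf : f ∈ P.faces)
    {a b c d : V} (h1 : s(a, b) ∈ f) (h2 : s(b, c) ∈ f) (h3 : s(c, d) ∈ f) (hac : a ≠ c)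
    (hbd : b ≠ d) :
    (f.card = 5 ∧ ∃ y, Cyc5 f a b c d y) ∨ (f.card = 6 ∧ ∃ y z, Cyc6 f a b c d y z) := by
  rcases path3 hP hf h1 h2 hac with ⟨hc, x, y, h⟩ | ⟨hc, x, y, z, h⟩
  · refine Or.inl ⟨hc, y, ?_⟩
    have : d = x := by have h1 := h.1; rw [h.mem] at h3; grind
    subst this; exact h
  · refine Or.inr ⟨hc, y, z, ?_⟩
    have : d = x := by have h1 := h.1; rw [h.mem] at h3; grind
    subst this; exact h

lemma path5 {P : PlaneGraph V} (hP : IsFullerene P) {f : Finset (Sym2 V)} (hf : f ∈ P.faces)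
    {a b c d e : V} (h1 : s(a, b) ∈ f) (h2 : s(b, c) ∈ f) (h3 : s(c, d) ∈ f) (h4 : s(d, e) ∈ f)
    (hac : a ≠ c) (hbd : b ≠ d) (hce : c ≠ e) :
    (f.card = 5 ∧ Cyc5 f a b c d e) ∨ (f.card = 6 ∧ ∃ z, Cyc6 f a b c d e z) := by
  rcases path4 hP hf h1 h2 h3 hac hbd with ⟨hc, y, h⟩ | ⟨hc, y, z, h⟩
  · refine Or.inl ⟨hc, ?_⟩
    have : e = y := by have h1 := h.1; rw [h.mem] at h4; grind
    subst this; exact h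
  · refine Or.inr ⟨hc, z, ?_⟩
    have : e = y := by have h1 := h.1; rw [h.mem] at h4; grind
    subst this; exact h

lemma path6 {P : PlaneGraph V} (hP : IsFullerene P) {f : Finset (Sym2 V)} (hf : f ∈ P.faces)
    {a b c d e g : V} (h1 : s(a, b) ∈ f) (h2 : s(b, c) ∈ f) (h3 : s(c, d) ∈ f) (h4 : s(d, e) ∈ f)
    (h5 : s(e, g) ∈ f) (hac : a ≠ c) (hbd : b ≠ d) (hce : c ≠ e) (hdg : d ≠ g) (hag : a ≠ g) :
    f.card = 6 ∧ Cyc6 f a b c d e g := by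
  rcases path5 hP hf h1 h2 h3 h4 hac hbd hce with ⟨hc, h⟩ | ⟨hc, z, h⟩
  · exfalso
    have h1 := h.1; rw [h.mem] at h5; grind
  · refine ⟨hc, ?_⟩
    have : g = z := by have h1 := h.1; rw [h.mem] at h5; grind
    subst this; exact h


/-! ### Even edge sets are cuts (simple connectivity of the sphere) -/

/-- The graph is connected. -/
lemma fullerene_connected {P : PlaneGraph V} (hP : IsFullerene P) : P.graph.Connected := by
  have h := hP.threeConnected ∅ (by simp)
  have hall : (∅ : Set V)ᶜ = Set.univ := by simp
  rw [hall] at h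
  exact (SimpleGraph.induceUnivIso P.graph).connected_iff.1 h

/-- A function constant along edges is constant. -/
lemma const_of_adj {P : PlaneGraph V} (hP : IsFullerene P) {α : Type} (g : V → α)
    (h : ∀ u v, P.graph.Adj u v → g u = g v) (u v : V) : g u = g v := by
  obtain ⟨w⟩ := (fullerene_connected hP).preconnected u v
  induction w with
  | nil => rfl
  | cons hadj _ ih => exact (h _ _ hadj).trans ih

/-- Edge type. -/
abbrev Eg (P : PlaneGraph V) : Type := {e : Sym2 V // e ∈ P.graph.edgeSet}

/-- Face type. -/
abbrev Fc (P : PlaneGraph V) : Type := {f : Finset (Sym2 V) // f ∈ P.faces}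

noncomputable instance (P : PlaneGraph V) : Fintype (Eg P) := Fintype.ofFinite _

/-- Edge-vertex incidence matrix mod 2. -/
def matA (P : PlaneGraph V) : Matrix (Eg P) V (ZMod 2) :=
  fun e v => if v ∈ e.1 then 1 else 0

/-- Face-edge incidence matrix mod 2. -/
def matB (P : PlaneGraph V) : Matrix (Fc P) (Eg P) (ZMod 2) :=
  fun f e => if e.1 ∈ f.1 then 1 else 0

lemma matA_mulVec (P : PlaneGraph V) (g : V → ZMod 2) (u v : V) (h : s(u, v) ∈ P.graph.edgeSet) :
    (matA P).mulVec g ⟨s(u, v), h⟩ = g u + g v := by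
  have huv : u ≠ v := by
    have : P.graph.Adj u v := by simpa using h
    exact this.ne
  have : ∀ x : V, (if x = u ∨ x = v then (1 : ZMod 2) else 0) * g x =
      (if x = u then g u else 0) + (if x = v then g v else 0) := by
    intro x
    by_cases h1 : x = u
    · subst h1; simp [huv]
    · by_cases h2 : x = v
      · subst h2; simp [h1]
      · simp [h1, h2]
  simp only [Matrix.mulVec, dotProduct, matA, Sym2.mem_iff, this, Finset.sum_add_distrib,
    Finset.sum_ite_eq', Finset.mem_univ, if_true]

lemma matB_vec (P : PlaneGraph V) (g : Fc P → ZMod 2) (e : Eg P) :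
    (matB P).transpose.mulVec g e = ∑ f ∈ Finset.univ.filter (fun f : Fc P => e.1 ∈ f.1), g f := by
  simp only [Matrix.mulVec, dotProduct, matB, Matrix.transpose_apply, Finset.sum_filter, ite_mul,
    one_mul, zero_mul]

lemma matB_face_eq {P : PlaneGraph V} (g : Fc P → ZMod 2)
    (hg : (matB P).transpose.mulVec g = 0) (f1 f2 : Fc P) (e : Sym2 V) (h1 : e ∈ f1.1)
    (h2 : e ∈ f2.1) : g f1 = g f2 := by
  by_cases hne : f1 = f2
  · rw [hne]
  have he : e ∈ P.graph.edgeSet := P.face_edges _ f1.2 _ h1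
  have h := congrFun hg ⟨e, he⟩
  rw [matB_vec] at h
  have hset : Finset.univ.filter (fun f : Fc P => e ∈ f.1) = {f1, f2} := by
    symm
    apply Finset.eq_of_subset_of_card_le
    · intro f hf
      simp only [Finset.mem_insert, Finset.mem_singleton] at hf
      rcases hf with rfl | rfl <;> simp [*]
    · rw [Finset.card_pair hne, ← P.edge_faces e he]
      apply Finset.card_le_card_of_injOn (fun f : Fc P => f.1)
      · intro f hf
        simp only [Finset.coe_filter, Finset.mem_univ, true_and, Set.mem_setOf_eq] at hf
        simp [hf, f.2]
      · intro a _ b _ hab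
        exact Subtype.ext hab
  simp only at h
  rw [hset, Finset.sum_pair hne] at h
  have h' : g f1 + g f2 = 0 := h
  have := CharTwo.add_eq_zero.1 h'
  exact this

lemma edge_count (P : PlaneGraph V) : ∑ f ∈ P.faces, f.card = 2 * Fintype.card (Eg P) := by
  classical
  have h1 : ∀ f ∈ P.faces, f.card = ∑ e : Eg P, if e.1 ∈ f then 1 else 0 := by
    intro f hf
    rw [← Finset.sum_filter, Finset.sum_const, smul_eq_mul, mul_one]
    symm
    apply Finset.card_bij (fun (e : Eg P) _ => e.1)
    · intro e he; simpa using he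
    · intro a _ b _ hab; exact Subtype.ext hab
    · intro e he
      exact ⟨⟨e, P.face_edges f hf e he⟩, by simpa using he, rfl⟩
  rw [Finset.sum_congr rfl h1, Finset.sum_comm]
  have h2 : ∀ e : Eg P, (∑ f ∈ P.faces, if e.1 ∈ f then 1 else 0) = 2 := by
    intro e
    rw [← Finset.sum_filter, Finset.sum_const, smul_eq_mul, mul_one]
    exact P.edge_faces e.1 e.2
  rw [Finset.sum_congr rfl (fun e _ => h2 e)]
  simp [mul_comm]

lemma finrank_ker_le {m n : Type} [Fintype m] [Fintype n] [DecidableEq n]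
    (A : Matrix m n (ZMod 2))
    (h : ∀ g, A.mulVec g = 0 → ∃ c : ZMod 2, g = fun _ => c) :
    Fintype.card n ≤ A.rank + 1 := by
  have h1 := LinearMap.finrank_range_add_finrank_ker A.mulVecLin
  have h2 : LinearMap.ker A.mulVecLin ≤ Submodule.span (ZMod 2) {(fun _ => 1 : n → ZMod 2)} := by
    intro g hg
    obtain ⟨c, rfl⟩ := h g (by simpa using hg)
    rw [Submodule.mem_span_singleton]
    exact ⟨c, by ext; simp⟩
  have h3 := Submodule.finrank_mono h2
  have h4 : Module.finrank (ZMod 2) (Submodule.span (ZMod 2) {(fun _ => 1 : n → ZMod 2)}) ≤ 1 :=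
    (finrank_span_le_card _).trans (by simp)
  rw [Module.finrank_fintype_fun_eq_card] at h1
  unfold Matrix.rank
  omega

lemma face_vertex_even {P : PlaneGraph V} (hP : IsFullerene P) (f : Fc P) (v : V) :
    (∑ e : Eg P, matB P f e * matA P e v) = 0 := by
  have : ∀ e : Eg P, matB P f e * matA P e v = if (e.1 ∈ f.1 ∧ v ∈ e.1) then 1 else 0 := by
    intro e
    simp only [matA, matB]
    by_cases h1 : e.1 ∈ f.1 <;> by_cases h2 : v ∈ e.1 <;> simp [h1, h2]
  simp only [this]
  rw [← Finset.sum_filter, Finset.sum_const]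
  by_cases hv : v ∈ edgeVerts f.1
  · obtain ⟨q, hq⟩ := mem_edgeVerts.1 hv
    obtain ⟨r, hr, ht⟩ := face_deg hP f.2 hq
    have hr' : s(v, r) ∈ f.1 := (ht r).2 (Or.inr rfl)
    have hset : Finset.univ.filter (fun e : Eg P => e.1 ∈ f.1 ∧ v ∈ e.1) =
        {⟨s(v, q), P.face_edges _ f.2 _ hq⟩, ⟨s(v, r), P.face_edges _ f.2 _ hr'⟩} := by
      ext ⟨e, he⟩
      simp only [Finset.mem_filter, Finset.mem_univ, true_and, Finset.mem_insert,
        Finset.mem_singleton, Subtype.mk.injEq]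
      constructor
      · rintro ⟨h1, t, rfl⟩
        rcases (ht t).1 h1 with rfl | rfl <;> simp
      · rintro (rfl | rfl)
        · exact ⟨hq, by simp⟩
        · exact ⟨hr', by simp⟩
    rw [hset, Finset.card_pair]
    · exact two_nsmul _ |>.trans (by decide)
    · intro h
      have h' := congrArg Subtype.val h
      simp only [Sym2.eq_iff] at h'
      grind
  · have hset : Finset.univ.filter (fun e : Eg P => e.1 ∈ f.1 ∧ v ∈ e.1) = ∅ := by
      ext ⟨e, he⟩
      simp only [Finset.mem_filter, Finset.mem_univ, true_and, Finset.notMem_empty, iff_false]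
      rintro ⟨h1, t, rfl⟩
      exact hv (mem_edgeVerts.2 ⟨t, h1⟩)
    rw [hset]; simp

lemma ker_le_range {P : PlaneGraph V} (hP : IsFullerene P) :
    LinearMap.range (matA P).mulVecLin = LinearMap.ker (matB P).mulVecLin := by
  have hA : Fintype.card V ≤ (matA P).rank + 1 := by
    apply finrank_ker_le
    intro g hg
    have hne : Nonempty V := (fullerene_connected hP).nonempty
    obtain ⟨v0⟩ := hne
    refine ⟨g v0, funext fun v => const_of_adj hP g ?_ v v0⟩
    intro u v huv
    have h := congrFun hg ⟨s(u, v), by simpa using huv⟩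
    rw [matA_mulVec] at h
    exact CharTwo.add_eq_zero.1 h
  have hB : Fintype.card (Fc P) ≤ (matB P).rank + 1 := by
    rw [← Matrix.rank_transpose (matB P)]
    apply finrank_ker_le
    intro g hg
    have key := matB_face_eq g hg
    have hex : ∀ v : V, ∃ f : Fc P, v ∈ edgeVerts f.1 := by
      intro v
      obtain ⟨p, q, r, hN⟩ := exists_nb hP v
      obtain ⟨f, k, hf, -, -, hf', -⟩ := two_faces ((hN.2.2.2 p).2 (Or.inl rfl))
      exact ⟨⟨f, hf⟩, mem_edgeVerts.2 ⟨p, hf'⟩⟩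
    choose F hF using hex
    have hsame : ∀ v (f1 f2 : Fc P), v ∈ edgeVerts f1.1 → v ∈ edgeVerts f2.1 → g f1 = g f2 := by
      intro v f1 f2 h1 h2
      obtain ⟨w, hw1, hw2⟩ := share_edge hP f1.2 f2.2 h1 h2
      exact key f1 f2 _ hw1 hw2
    have hadj : ∀ u v, P.graph.Adj u v → g (F u) = g (F v) := by
      intro u v huv
      obtain ⟨f, k, hf, -, -, hf', -⟩ := two_faces huv
      have h1 : u ∈ edgeVerts f := mem_edgeVerts.2 ⟨v, hf'⟩
      have h2 : v ∈ edgeVerts f := mem_edgeVerts.2 ⟨u, by rwa [Sym2.eq_swap]⟩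
      rw [hsame u (F u) ⟨f, hf⟩ (hF u) h1, hsame v (F v) ⟨f, hf⟩ (hF v) h2]
    obtain ⟨v0⟩ : Nonempty V := (fullerene_connected hP).nonempty
    refine ⟨g (F v0), funext fun f => ?_⟩
    have hv : ∃ v, v ∈ edgeVerts f.1 := by
      have hpos : f.1.Nonempty := by
        rw [← Finset.card_pos]
        rcases hP.faceSize f.1 f.2 with h | h <;> omega
      obtain ⟨e, he⟩ := hpos
      induction e using Sym2.ind with
      | _ x y => exact ⟨x, mem_edgeVerts.2 ⟨y, he⟩⟩
    obtain ⟨v, hv⟩ := hv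
    rw [hsame v f (F v) hv (hF v)]
    exact const_of_adj hP (fun v => g (F v)) hadj v v0
  have hle : LinearMap.range (matA P).mulVecLin ≤ LinearMap.ker (matB P).mulVecLin := by
    rintro _ ⟨g, rfl⟩
    rw [LinearMap.mem_ker, Matrix.mulVecLin_apply, Matrix.mulVecLin_apply, Matrix.mulVec_mulVec]
    have : matB P * matA P = 0 := by
      ext f v
      rw [Matrix.mul_apply]
      exact face_vertex_even hP f v
    rw [this, Matrix.zero_mulVec]
  apply Submodule.eq_of_le_of_finrank_le hle
  have h1 := LinearMap.finrank_range_add_finrank_ker (matB P).mulVecLin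
  rw [Module.finrank_fintype_fun_eq_card] at h1
  have h2 := P.euler
  rw [edge_count] at h2
  have h3 : Fintype.card (Fc P) = P.faces.card := Fintype.card_coe _
  unfold Matrix.rank at hA hB
  omega

/-- An edge set meeting every face evenly is a cut. -/
lemma exists_cut {P : PlaneGraph V} (hP : IsFullerene P) (D : Finset (Sym2 V))
    (hD : ∀ f ∈ P.faces, Even (f ∩ D).card) :
    ∃ S : V → Prop, ∀ u v, P.graph.Adj u v → (s(u, v) ∈ D ↔ ¬ (S u ↔ S v)) := by
  have hmem : (fun e : Eg P => if e.1 ∈ D then (1 : ZMod 2) else 0) ∈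
      LinearMap.ker (matB P).mulVecLin := by
    rw [LinearMap.mem_ker, Matrix.mulVecLin_apply]
    ext f
    have : ∀ e : Eg P, matB P f e * (if e.1 ∈ D then (1 : ZMod 2) else 0) =
        if e.1 ∈ f.1 ∩ D then 1 else 0 := by
      intro e
      simp only [matB, Finset.mem_inter]
      by_cases h1 : e.1 ∈ f.1 <;> by_cases h2 : e.1 ∈ D <;> simp [h1, h2]
    simp only [Matrix.mulVec, dotProduct, this, Pi.zero_apply]
    rw [← Finset.sum_filter, Finset.sum_const]
    have hc : (Finset.univ.filter (fun e : Eg P => e.1 ∈ f.1 ∩ D)).card = (f.1 ∩ D).card := by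
      apply Finset.card_bij (fun (e : Eg P) _ => e.1)
      · intro e he; simpa using he
      · intro a _ b _ hab; exact Subtype.ext hab
      · intro e he
        exact ⟨⟨e, P.face_edges f.1 f.2 e (Finset.mem_inter.1 he).1⟩, by simpa using he, rfl⟩
    rw [hc, nsmul_eq_mul, mul_one]
    exact (ZMod.natCast_eq_zero_iff_even).2 (hD f.1 f.2)
  rw [← ker_le_range hP] at hmem
  obtain ⟨g, hg⟩ := hmem
  refine ⟨fun v => g v = 1, fun u v huv => ?_⟩
  have h := congrFun hg ⟨s(u, v), by simpa using huv⟩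
  rw [Matrix.mulVecLin_apply, matA_mulVec] at h
  simp only at h
  have key : ∀ x y : ZMod 2, (x + y = 1 ↔ ¬ (x = 1 ↔ y = 1)) := by decide
  rw [← key, h]
  by_cases hD' : s(u, v) ∈ D <;> simp [hD']


/-! ### Consequences of extremality -/

lemma mem_facesVerts {H : Finset (Finset (Sym2 V))} {v : V} :
    v ∈ facesVerts H ↔ ∃ h ∈ H, v ∈ edgeVerts h := by
  simp only [facesVerts, edgeVerts, Finset.mem_filter, Finset.mem_univ, true_and, Finset.mem_sup,
    id]
  constructor
  · rintro ⟨e, ⟨h, hh, he⟩, hv⟩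
    exact ⟨h, hh, e, he, hv⟩
  · rintro ⟨h, hh, e, he, hv⟩
    exact ⟨e, ⟨h, hh, he⟩, hv⟩

/-- The uncovered vertex `u` of the pentagon `p ⊆ G` is not matched along an edge of `p`. -/
def Lv (P : PlaneGraph V) (E : Finset (Sym2 V)) (H : Finset (Finset (Sym2 V)))
    (M : Finset (Sym2 V)) (p : Finset (Sym2 V)) (u : V) : Prop :=
  p ∈ P.faces ∧ p.card = 5 ∧ p ⊆ E ∧ u ∈ edgeVerts p ∧ u ∉ facesVerts H ∧
    ∀ w, s(u, w) ∈ M → s(u, w) ∉ p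

structure Pre (P : PlaneGraph V) (E : Finset (Sym2 V)) (H : Finset (Finset (Sym2 V)))
    (M : Finset (Sym2 V)) : Prop where
  adj : ∀ {u w}, s(u, w) ∈ E → P.graph.Adj u w
  hex : ∀ {h}, h ∈ H → h ∈ P.faces ∧ h.card = 6
  disj : ∀ {h k v}, h ∈ H → k ∈ H → v ∈ edgeVerts h → v ∈ edgeVerts k → h = k
  mE : ∀ {u w}, s(u, w) ∈ M → s(u, w) ∈ E
  mU : ∀ {u w w'}, s(u, w) ∈ M → s(u, w') ∈ M → w = w'
  mC : ∀ {u w}, s(u, w) ∈ M → u ∉ facesVerts H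
  deg3 : ∀ {u p q r}, Nb P u p q r → s(u, p) ∈ E → s(u, q) ∈ E → s(u, r) ∈ E →
    u ∉ facesVerts H → ∃ w, s(u, w) ∈ M

structure Clar (P : PlaneGraph V) (E : Finset (Sym2 V)) (H : Finset (Finset (Sym2 V)))
    (M : Finset (Sym2 V)) : Prop extends Pre P E H M where
  F1 : ∀ {u}, u ∈ edgeVerts E → u ∉ facesVerts H → ∃ p, Lv P E H M p u
  F2 : ∀ {p u u'}, Lv P E H M p u → Lv P E H M p u' → u = u'

lemma alt5 {a b c d e : Prop} (h0 : (e ∧ ¬ a) ∨ (¬ e ∧ a)) (h1 : (a ∧ ¬ b) ∨ (¬ a ∧ b))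
    (h2 : (b ∧ ¬ c) ∨ (¬ b ∧ c)) (h3 : (c ∧ ¬ d) ∨ (¬ c ∧ d)) (h4 : (d ∧ ¬ e) ∨ (¬ d ∧ e)) :
    False := by
  tauto

lemma sym2_ne {u w w' : V} (h : w ≠ w') : s(u, w) ≠ s(u, w') :=
  fun h' => h (Sym2.congr_right.1 h')

lemma Pre.exists_leave {P : PlaneGraph V} (hP : IsFullerene P) {E : Finset (Sym2 V)}
    {H : Finset (Finset (Sym2 V))} {M : Finset (Sym2 V)} (hC : Pre P E H M)
    {p : Finset (Sym2 V)} (hp : p ∈ P.faces) (h5 : p.card = 5) (hpE : p ⊆ E) :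
    ∃ u, Lv P E H M p u := by
  by_contra hno
  obtain ⟨v0, v1, v2, v3, v4, hc⟩ := face5 hp h5
  set N : V → V → Prop := fun u w => s(u, w) ∈ M ∨ ∃ h ∈ H, s(u, w) ∈ h with hN
  have hsymm : ∀ u w, N u w → N w u := by
    intro u w h
    simp only [hN] at h ⊢
    rwa [Sym2.eq_swap]
  have hex : ∀ v ∈ edgeVerts p, ∃ w, s(v, w) ∈ p ∧ N v w := by
    intro v hv
    by_cases hcv : v ∈ facesVerts H
    · obtain ⟨h, hh, hvh⟩ := mem_facesVerts.1 hcv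
      obtain ⟨w, h1, h2⟩ := share_edge hP hp (hC.hex hh).1 hv hvh
      exact ⟨w, h1, Or.inr ⟨h, hh, h2⟩⟩
    · by_contra hcon
      push Not at hcon
      refine hno ⟨v, hp, h5, hpE, hv, hcv, fun w hw hwp => hcon w hwp (Or.inl hw)⟩
  have huniq : ∀ v w w', s(v, w) ∈ p → s(v, w') ∈ p → N v w → N v w' → w = w' := by
    intro v w w' h1 h2 h3 h4
    rcases h3 with h3 | ⟨h, hh, h3⟩
    · rcases h4 with h4 | ⟨k, hk, h4⟩
      · exact hC.mU h3 h4
      · exact absurd (mem_facesVerts.2 ⟨k, hk, mem_edgeVerts.2 ⟨_, h4⟩⟩) (hC.mC h3)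
    · rcases h4 with h4 | ⟨k, hk, h4⟩
      · exact absurd (mem_facesVerts.2 ⟨h, hh, mem_edgeVerts.2 ⟨_, h3⟩⟩) (hC.mC h4)
      · have hhk := hC.disj hh hk (mem_edgeVerts.2 ⟨_, h3⟩) (mem_edgeVerts.2 ⟨_, h4⟩)
        subst hhk
        by_contra hne
        have := corner_unique hP hp (hC.hex hh).1 hne h1 h2 h3 h4
        have := (hC.hex hh).2
        subst p
        omega
  have key : ∀ a b c, s(b, a) ∈ p → s(b, c) ∈ p → a ≠ c →
      ((N a b ∧ ¬ N b c) ∨ (¬ N a b ∧ N b c)) := by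
    intro a b c h1 h2 hac
    obtain ⟨w, hw, hNw⟩ := hex b (mem_edgeVerts.2 ⟨_, h1⟩)
    have hu := huniq b a c h1 h2
    have s1 := hsymm a b
    have s2 := hsymm b a
    rcases no_all hP hp h1 h2 hw with h | rfl | rfl
    · exact absurd h hac
    · left; exact ⟨s2 hNw, fun h => hac (hu hNw h)⟩
    · right; exact ⟨fun h => hac (hu (s1 h) hNw), hNw⟩
  have hm := hc.mem
  obtain ⟨⟨h01, h02, h03, h04, h12, h13, h14, h23, h24, h34⟩, -⟩ := hc
  have k0 := key v4 v0 v1 (by simp [hm]) (by simp [hm]) (Ne.symm h14)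
  have k1 := key v0 v1 v2 (by simp [hm]) (by simp [hm]) h02
  have k2 := key v1 v2 v3 (by simp [hm]) (by simp [hm]) h13
  have k3 := key v2 v3 v4 (by simp [hm]) (by simp [hm]) h24
  have k4 := key v3 v4 v0 (by simp [hm]) (by simp [hm]) (Ne.symm h03)
  exact alt5 k0 k1 k2 k3 k4

lemma Pre.leave_inj {P : PlaneGraph V} (hP : IsFullerene P) {E : Finset (Sym2 V)}
    {H : Finset (Finset (Sym2 V))} {M : Finset (Sym2 V)} (hC : Pre P E H M)
    {p q : Finset (Sym2 V)} {u : V} (h1 : Lv P E H M p u) (h2 : Lv P E H M q u) : p = q := by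
  by_contra hpq
  obtain ⟨hp, -, hpE, hup, huc, hpM⟩ := h1
  obtain ⟨hq, -, hqE, huq, -, hqM⟩ := h2
  obtain ⟨w, hw1, hw2⟩ := share_edge hP hp hq hup huq
  obtain ⟨x, hxw, hx⟩ := face_deg hP hp hw1
  have hxp : s(u, x) ∈ p := (hx x).2 (Or.inr rfl)
  obtain ⟨y, hN⟩ := exists_third hP (face_adj hp hw1) (face_adj hp hxp) hxw.symm
  have hyq : s(u, y) ∈ q := face_step hP hq hp (Ne.symm hpq) hN hw2 hw1 hxp
  obtain ⟨t, ht⟩ := hC.deg3 hN (hpE hw1) (hpE hxp) (hqE hyq) huc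
  have := (hN.2.2.2 t).1 (hC.adj (hC.mE ht))
  rcases this with rfl | rfl | rfl
  · exact hpM _ ht hw1
  · exact hpM _ ht hxp
  · exact hqM _ ht hyq

lemma exists_clar {P : PlaneGraph V} (hP : IsFullerene P) {E : Finset (Sym2 V)}
    (hE : ∀ e ∈ E, e ∈ P.graph.edgeSet) (hext : IsExtremalSub P E) : ∃ H M, Clar P E H M := by
  obtain ⟨H, ⟨⟨hH1, hH2, M, hM1, hM2, hM3, hM4⟩, -⟩, hcard⟩ := hext
  have hpre : Pre P E H M := by
    refine ⟨fun h => by simpa using hE _ h, fun h => ⟨(hH1 _ h).1, (hH1 _ h).2.1⟩, ?_,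
      fun h => hM1 h, ?_, ?_, ?_⟩
    · intro h k v hh hk hv hv'
      by_contra hne
      exact Finset.disjoint_left.1 (hH2 h hh k hk hne) hv hv'
    · intro u w w' h h'
      by_contra hne
      exact hM2.2 _ h _ h' (sym2_ne hne) u (by simp) (by simp)
    · intro u w h
      exact hM3 _ h u (by simp)
    · intro u p q r hN h1 h2 h3 hu
      have hd : deg E u = 3 := by
        unfold deg
        have : E.filter (fun e => u ∈ e) = {s(u, p), s(u, q), s(u, r)} := by
          ext e
          induction e using Sym2.inductionOn with
          | _ x y =>
          simp only [Finset.mem_filter, Finset.mem_insert, Finset.mem_singleton, Sym2.mem_iff]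
          constructor
          · rintro ⟨he, rfl | rfl⟩
            · have := (hN.2.2.2 y).1 (by simpa using hE _ he)
              rcases this with rfl | rfl | rfl <;> simp
            · rw [Sym2.eq_swap] at he ⊢
              have := (hN.2.2.2 x).1 (by simpa using hE _ he)
              rcases this with rfl | rfl | rfl <;> simp
          · rintro (h | h | h)
            · rw [h]; refine ⟨h1, ?_⟩
              have : u ∈ s(x, y) := by rw [h]; simp
              simpa using this
            · rw [h]; refine ⟨h2, ?_⟩
              have : u ∈ s(x, y) := by rw [h]; simp
              simpa using this
            · rw [h]; refine ⟨h3, ?_⟩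
              have : u ∈ s(x, y) := by rw [h]; simp
              simpa using this
        rw [this]
        obtain ⟨a, b, c, -⟩ := hN
        rw [Finset.card_eq_three]
        exact ⟨_, _, _, sym2_ne a, sym2_ne b, sym2_ne c, rfl⟩
      obtain ⟨e, he, hue⟩ := hM4 u (mem_edgeVerts.2 ⟨_, h1⟩) hd hu
      obtain ⟨w, rfl⟩ := hue
      exact ⟨w, he⟩
  have hL : ∀ p ∈ pentFaces P E, ∃ u, Lv P E H M p u := by
    intro p hp
    simp only [pentFaces, Finset.mem_filter] at hp
    exact hpre.exists_leave hP hp.1 hp.2.1 hp.2.2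
  have hne : Nonempty V := (fullerene_connected hP).nonempty
  choose! φ hφ using hL
  have hmaps : ∀ p ∈ pentFaces P E, φ p ∈ Uset E H := by
    intro p hp
    obtain ⟨-, -, h1, h2, h3, -⟩ := hφ p hp
    obtain ⟨w, hw⟩ := mem_edgeVerts.1 h2
    simp only [Uset, Finset.mem_sdiff]
    exact ⟨mem_edgeVerts.2 ⟨w, h1 hw⟩, h3⟩
  have hinj : Set.InjOn φ (pentFaces P E) := by
    intro p hp q hq h
    exact hpre.leave_inj hP (hφ p hp) (h ▸ hφ q hq)
  have hsurj := Finset.surjOn_of_injOn_of_card_le φ hmaps hinj hcard.le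
  have hF : ∀ u ∈ Uset E H, ∃ p ∈ pentFaces P E, φ p = u := fun u hu => hsurj hu
  refine ⟨H, M, hpre, ?_, ?_⟩
  · intro u hu hu'
    obtain ⟨p, hp, rfl⟩ := hF u (by simp [Uset, hu, hu'])
    exact ⟨p, hφ p hp⟩
  · have key : ∀ p u, Lv P E H M p u → φ p = u := by
      intro p u h
      obtain ⟨h1, h2, h3, h4, h5, h6⟩ := h
      obtain ⟨w, hw⟩ := mem_edgeVerts.1 h4
      obtain ⟨q, hq, hqu⟩ := hF u (by simp only [Uset, Finset.mem_sdiff]; exact ⟨mem_edgeVerts.2 ⟨w, h3 hw⟩, h5⟩)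
      have := hpre.leave_inj hP ⟨h1, h2, h3, h4, h5, h6⟩ (hqu ▸ hφ q hq)
      rw [this, hqu]
    intro p u u' h h'
    rw [← key p u h, ← key p u' h']


/-! ### The ring data -/

structure RD (P : PlaneGraph V) (R : ZMod 6 → Finset (Sym2 V)) (a b e : ZMod 6 → V)
    (inn : ZMod 6 → Bool) : Prop where
  face : ∀ i, R i ∈ P.faces
  c5 : ∀ i, (R i).card = 5
  inj : ∀ {i j}, R i = R j → i = j
  cycI : ∀ {j i}, i = j + 1 → inn i = true → Cyc5 (R i) (a j) (e i) (a i) (b i) (b j)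
  cycO : ∀ {j i}, i = j + 1 → inn i = false → Cyc5 (R i) (a j) (a i) (b i) (e i) (b j)
  ainj : ∀ {i j}, a i = a j → i = j
  binj : ∀ {i j}, b i = b j → i = j
  einj : ∀ {i j}, e i = e j → i = j
  ab : ∀ {i j}, a i ≠ b j
  ae : ∀ {i j}, a i ≠ e j
  be : ∀ {i j}, b i ≠ e j

lemma zmod_tri : ∀ i j : ZMod 6, (i = j ∨ j = i + 1 ∨ i = j + 1) →
    (i + 1 = j ∨ j = i + 1 + 1 ∨ i + 1 = j + 1) → j = i ∨ j = i + 1 := by decide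

set_option maxHeartbeats 1000000 in
lemma exists_rd {P : PlaneGraph V} (hP : IsFullerene P) {R : ZMod 6 → Finset (Sym2 V)}
    (hR : IsPentRing P 6 R) : ∃ a b e inn, RD P R a b e inn := by
  obtain ⟨hinj, hface, hadj⟩ := hR
  have dis : ∀ {v i j}, v ∈ edgeVerts (R i) → v ∈ edgeVerts (R j) → i = j ∨ j = i + 1 ∨ i = j + 1 := by
    intro v i j h1 h2
    by_cases hij : i = j
    · exact Or.inl hij
    · exact Or.inr ((hadj i j hij).1 ⟨v, by simp [h1, h2]⟩)
  have tri : ∀ {v i j}, v ∈ edgeVerts (R i) → v ∈ edgeVerts (R (i + 1)) → v ∈ edgeVerts (R j) →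
      j = i ∨ j = i + 1 := fun {v i j} h1 h2 h3 => zmod_tri i j (dis h1 h3) (dis h2 h3)
  have hsh : ∀ i, ∃ c d, s(c, d) ∈ R i ∧ s(c, d) ∈ R (i + 1) := by
    intro i
    have hne : i ≠ i + 1 := by revert i; decide
    obtain ⟨v, hv⟩ := (hadj i (i + 1) hne).2 (Or.inl rfl)
    rw [Finset.mem_inter] at hv
    obtain ⟨w, h1, h2⟩ := share_edge hP (hface i).1 (hface (i + 1)).1 hv.1 hv.2
    exact ⟨v, w, h1, h2⟩
  choose c d hcd1 hcd2 using hsh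
  have vert : ∀ {u v : V} {f : Finset (Sym2 V)}, s(u, v) ∈ f → u ∈ edgeVerts f :=
    fun h => mem_edgeVerts.2 ⟨_, h⟩
  have hsR : ∀ {i j}, s(c j, d j) ∈ R i → i = j ∨ i = j + 1 := by
    intro i j h
    exact tri (vert (hcd1 j)) (vert (hcd2 j)) (vert h)
  have hsne : ∀ {i j}, s(c i, d i) = s(c j, d j) → i = j := by
    intro i j h
    have h1 := hsR (i := i) (j := j) (h ▸ hcd1 i)
    have h2 := hsR (i := i + 1) (j := j) (h ▸ hcd2 i)
    revert h1 h2; clear h; revert i j; decide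
  set D : Finset (Sym2 V) := Finset.univ.image (fun i => s(c i, d i)) with hDdef
  have hDm : ∀ {x}, x ∈ D ↔ ∃ j, s(c j, d j) = x := by
    intro x; simp [hDdef]
  have hRD : ∀ {j i x}, i = j + 1 → x ∈ R i → x ∈ D → x = s(c i, d i) ∨ x = s(c j, d j) := by
    intro j i x hij hx hD
    obtain ⟨k, rfl⟩ := hDm.1 hD
    rcases hsR hx with h | h
    · subst h; exact Or.inl rfl
    · have : k = j := by rw [hij] at h; exact (add_right_cancel h).symm
      subst this; exact Or.inr rfl
  have hEven : ∀ f ∈ P.faces, Even (f ∩ D).card := by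
    intro f hf
    by_cases hfr : ∃ i, f = R i
    · obtain ⟨i, rfl⟩ := hfr
      have hi : i = (i - 1) + 1 := by ring
      have : R i ∩ D = {s(c i, d i), s(c (i - 1), d (i - 1))} := by
        ext x
        simp only [Finset.mem_inter, Finset.mem_insert, Finset.mem_singleton]
        constructor
        · rintro ⟨h1, h2⟩; exact hRD hi h1 h2
        · rintro (rfl | rfl)
          · exact ⟨hcd1 i, hDm.2 ⟨_, rfl⟩⟩
          · refine ⟨?_, hDm.2 ⟨_, rfl⟩⟩
            have := hcd2 (i - 1)
            rwa [← hi] at this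
      rw [this, Finset.card_pair]
      · decide
      · intro h
        have h := hsne h
        revert h; clear * -; revert i; decide
    · have : f ∩ D = ∅ := by
        rw [Finset.eq_empty_iff_forall_notMem]
        intro x hx
        rw [Finset.mem_inter] at hx
        obtain ⟨j, rfl⟩ := hDm.1 hx.2
        rcases no_three hf (hface j).1 (hface (j + 1)).1 hx.1 (hcd1 j) (hcd2 j) with h | h | h
        · exact hfr ⟨_, h⟩
        · exact hfr ⟨_, h⟩
        · have h := hinj h
          revert h; clear * -; revert j; decide
      rw [this]; simp
  obtain ⟨S, hS⟩ := exists_cut hP D hEven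
  have hab : ∀ j, ∃ a b, s(a, b) = s(c j, d j) ∧ S a ∧ ¬ S b := by
    intro j
    have h := (hS (c j) (d j) (face_adj (hface j).1 (hcd1 j))).1 (hDm.2 ⟨j, rfl⟩)
    by_cases h1 : S (c j)
    · exact ⟨c j, d j, rfl, h1, by tauto⟩
    · exact ⟨d j, c j, Sym2.eq_swap, by tauto, h1⟩
  choose a b hab1 hab2 hab3 using hab
  have abR : ∀ j, s(a j, b j) ∈ R j := fun j => by rw [hab1]; exact hcd1 j
  have abR1 : ∀ {j i}, i = j + 1 → s(a j, b j) ∈ R i := fun {j i} h => by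
    rw [hab1, h]; exact hcd2 j
  have baR : ∀ j, s(b j, a j) ∈ R j := fun j => by rw [Sym2.eq_swap]; exact abR j
  have baR1 : ∀ {j i}, i = j + 1 → s(b j, a j) ∈ R i := fun {j i} h => by
    rw [Sym2.eq_swap]; exact abR1 h
  have hsame : ∀ {j i u v}, i = j + 1 → s(u, v) ∈ R i → ¬ (S u ↔ S v) →
      s(u, v) = s(a i, b i) ∨ s(u, v) = s(a j, b j) := by
    intro j i u v hij h1 h2
    rw [hab1, hab1]
    exact hRD hij h1 ((hS u v (face_adj (hface i).1 h1)).2 h2)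
  have va : ∀ {i k}, a i ∈ edgeVerts (R k) → k = i ∨ k = i + 1 := fun {i k} h =>
    tri (vert (abR i)) (vert (abR1 rfl)) h
  have vb : ∀ {i k}, b i ∈ edgeVerts (R k) → k = i ∨ k = i + 1 := fun {i k} h =>
    tri (vert (baR i)) (vert (baR1 rfl)) h
  have ainj : ∀ {i j}, a i = a j → i = j := by
    intro i j h
    have h1 := va (h ▸ vert (abR i))
    have h2 := va (h ▸ vert (abR1 (j := i) rfl))
    revert h1 h2; clear * -; revert i j; decide
  have binj : ∀ {i j}, b i = b j → i = j := by
    intro i j h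
    have h1 := vb (h ▸ vert (baR i))
    have h2 := vb (h ▸ vert (baR1 (j := i) rfl))
    revert h1 h2; clear * -; revert i j; decide
  have habne : ∀ {i j}, a i ≠ b j := by
    intro i j h
    exact hab3 j (h ▸ hab2 i)
  have hcyc : ∀ i, ∃ x, (S x ∧ Cyc5 (R i) (a (i - 1)) x (a i) (b i) (b (i - 1))) ∨
      (¬ S x ∧ Cyc5 (R i) (a (i - 1)) (a i) (b i) x (b (i - 1))) := by
    intro i
    have hi : i = (i - 1) + 1 := by ring
    have hne : i ≠ i - 1 := by clear * -; revert i; decide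
    generalize i - 1 = j at *
    obtain ⟨u0, v0, w0, x0, y0, hc0⟩ := face5 (hface i).1 (hface i).2
    obtain ⟨w, x, y, hc⟩ := cyc5_edge hc0 (abR i)
    have hm := hc.mem
    have hd := hc.1
    have hmj := (hm (a j) (b j)).1 (abR1 hi)
    have n1 : a j ≠ a i := fun h => hne (ainj h).symm
    have n2 : b j ≠ b i := fun h => hne (binj h).symm
    have n3 : a j ≠ b i := habne
    have n4 : a i ≠ b j := habne
    have Sai := hab2 i
    have Saj := hab2 j
    have Sbi := hab3 i
    have Sbj := hab3 j
    have e1 : s(b i, w) ∈ R i := by simp [hm]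
    have e2 : s(a i, y) ∈ R i := by simp [hm]
    have e3 : s(x, y) ∈ R i := by simp [hm]
    have e4 : s(w, x) ∈ R i := by simp [hm]
    have q1 := hsame hi e1
    have q2 := hsame hi e2
    have q3 := hsame hi e3
    have q4 := hsame hi e4
    simp only [Sym2.eq_iff] at q1 q2 q3 q4
    have hcases : (a j = w ∧ b j = x) ∨ (a j = x ∧ b j = w) ∨ (a j = x ∧ b j = y) ∨
        (a j = y ∧ b j = x) := by
      rcases hmj with h | h | h | h | h | h | h | h | h | h
      · exact absurd h.1 n1
      · exact absurd h.1 n3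
      · exact absurd h.1 n3
      · exact absurd h.2 n2
      · exact Or.inl h
      · exact Or.inr (Or.inl h)
      · exact Or.inr (Or.inr (Or.inl h))
      · exact Or.inr (Or.inr (Or.inr h))
      · exact absurd h.2 n4.symm
      · exact absurd h.1 n1
    obtain ⟨d1, d2, d3, d4, d5, d6, d7, d8, d9, d10⟩ := hd
    rcases hcases with ⟨h1, h2⟩ | ⟨h1, h2⟩ | ⟨h1, h2⟩ | ⟨h1, h2⟩
    · subst h1; subst h2
      exfalso
      have := q1 (fun hh => Sbi (hh.2 Saj))
      rcases this with (h | h) | h | h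
      · exact d1 h.1.symm
      · exact n1 h.2
      · exact n3 h.1.symm
      · exact n2 h.1.symm
    · subst h1; subst h2
      refine ⟨y, Or.inl ⟨?_, hc.rot.rot.rot⟩⟩
      by_contra hy
      have := q3 (fun hh => hy (hh.1 Saj))
      rcases this with (h | h) | h | h
      · exact n1 h.1
      · exact n3 h.1
      · exact d9 h.2.symm
      · exact d8 h.1.symm
    · subst h1; subst h2
      exfalso
      have := q2 (fun hh => Sbj (hh.1 Sai))
      rcases this with (h | h) | h | h
      · exact n2 h.2
      · exact d1 h.1
      · exact n1 h.1.symm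
      · exact d4 h.1
    · subst h1; subst h2
      refine ⟨w, Or.inr ⟨?_, hc.rot.rot.rot.rot⟩⟩
      intro hw
      have := q4 (fun hh => Sbj (hh.1 hw))
      rcases this with (h | h) | h | h
      · exact d2 h.1.symm
      · exact d5 h.1.symm
      · exact d9 h.1
      · exact d10 h.2
  choose e he using hcyc
  have hsub1 : ∀ {i : ZMod 6}, i = (i - 1) + 1 := by intro i; ring
  have eR : ∀ i, e i ∈ edgeVerts (R i) := by
    intro i
    rcases he i with ⟨-, h⟩ | ⟨-, h⟩ <;> simp [h.verts]
  have ve : ∀ {i k}, e i ∈ edgeVerts (R k) → k = i := by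
    intro i k hk
    by_contra hne
    obtain ⟨w, hw1, hw2⟩ := share_edge hP (hface i).1 (hface k).1 (eR i) hk
    have hw1' : s(w, e i) ∈ R i := by rw [Sym2.eq_swap]; exact hw1
    have hw2' : s(w, e i) ∈ R k := by rw [Sym2.eq_swap]; exact hw2
    have hnei : b i ≠ e i ∧ b (i - 1) ≠ e i ∧ a i ≠ e i ∧ a (i - 1) ≠ e i ∧
        (w = a i ∨ w = a (i - 1) ∨ w = b i ∨ w = b (i - 1)) := by
      rcases he i with ⟨-, h⟩ | ⟨-, h⟩
      · have hm := (h.mem _ _).1 hw1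
        obtain ⟨⟨d1, d2, d3, d4, d5, d6, d7, d8, d9, d10⟩, -⟩ := h
        refine ⟨d6.symm, d7.symm, d5.symm, d1, ?_⟩
        clear * - hm d1 d2 d3 d4 d5 d6 d7 d8 d9 d10
        grind
      · have hm := (h.mem _ _).1 hw1
        obtain ⟨⟨d1, d2, d3, d4, d5, d6, d7, d8, d9, d10⟩, -⟩ := h
        refine ⟨d8, d10.symm, d6, d3, ?_⟩
        clear * - hm d1 d2 d3 d4 d5 d6 d7 d8 d9 d10
        grind
    obtain ⟨f1, f2, f3, f4, hw⟩ := hnei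
    rcases hw with rfl | rfl | rfl | rfl
    · rcases va (vert hw2') with h | h
      · exact hne h
      · exact hne (hinj (corner_unique hP (hface k).1 (hface i).1 f1 (abR1 h) hw2' (abR i) hw1'))
    · rcases va (vert hw2') with h | h
      · exact hne (hinj (corner_unique hP (hface k).1 (hface i).1 f2 (h ▸ abR _) hw2' (abR1 hsub1) hw1'))
      · exact hne (h.trans hsub1.symm)
    · rcases vb (vert hw2') with h | h
      · exact hne h
      · exact hne (hinj (corner_unique hP (hface k).1 (hface i).1 f3 (baR1 h) hw2' (baR i) hw1'))
    · rcases vb (vert hw2') with h | h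
      · exact hne (hinj (corner_unique hP (hface k).1 (hface i).1 f4 (h ▸ baR _) hw2' (baR1 hsub1) hw1'))
      · exact hne (h.trans hsub1.symm)
  have aux : ∀ {i k : ZMod 6}, k = i → k + 1 = i → False := by clear * -; decide
  classical
  refine ⟨a, b, e, fun i => decide (S (e i)), fun i => (hface i).1, fun i => (hface i).2,
    fun h => hinj h, ?_, ?_, ainj, binj, ?_, habne, ?_, ?_⟩
  · intro j i hij hi
    have hj : j = i - 1 := by rw [hij]; ring
    have := he i
    simp only [decide_eq_true_eq] at hi
    rw [hj]; clear * - this hi; tauto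
  · intro j i hij hi
    have hj : j = i - 1 := by rw [hij]; ring
    have := he i
    simp only [decide_eq_false_iff_not] at hi
    rw [hj]; clear * - this hi; tauto
  · intro i j h
    exact ve (h ▸ eR i)
  · intro i j h
    exact aux (ve (h ▸ vert (abR i))) (ve (h ▸ vert (abR1 rfl)))
  · intro i j h
    exact aux (ve (h ▸ vert (baR i))) (ve (h ▸ vert (baR1 rfl)))


/-! ### Trivalent corners -/

/-- The vertex `u` has neighbours `p, q, r` and surrounding faces `A ∋ p, q`, `B ∋ q, r`,
`C ∋ r, p`. -/
structure Yv (P : PlaneGraph V) (u p q r : V) (A B C : Finset (Sym2 V)) : Prop where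
  nb : Nb P u p q r
  fA : A ∈ P.faces
  fB : B ∈ P.faces
  fC : C ∈ P.faces
  Ap : s(u, p) ∈ A
  Aq : s(u, q) ∈ A
  Bq : s(u, q) ∈ B
  Br : s(u, r) ∈ B
  Cr : s(u, r) ∈ C
  Cp : s(u, p) ∈ C

lemma sw {u v : V} {f : Finset (Sym2 V)} (h : s(u, v) ∈ f) : s(v, u) ∈ f := by
  rwa [Sym2.eq_swap]

lemma Yv.rot {P : PlaneGraph V} {u p q r : V} {A B C : Finset (Sym2 V)}
    (h : Yv P u p q r A B C) : Yv P u q r p B C A :=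
  ⟨nb_rot h.nb, h.fB, h.fC, h.fA, h.Bq, h.Br, h.Cr, h.Cp, h.Ap, h.Aq⟩

lemma Yv.neAB {P : PlaneGraph V} (hP : IsFullerene P) {u p q r : V} {A B C : Finset (Sym2 V)}
    (h : Yv P u p q r A B C) : A ≠ B := by
  rintro rfl
  obtain ⟨h1, h2, h3, -⟩ := h.nb
  rcases no_all hP h.fA h.Ap h.Aq h.Br with h | h | h <;> contradiction

lemma Yv.pB {P : PlaneGraph V} (hP : IsFullerene P) {u p q r : V} {A B C : Finset (Sym2 V)}
    (h : Yv P u p q r A B C) : s(u, p) ∉ B := by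
  intro h'
  obtain ⟨h1, h2, h3, -⟩ := h.nb
  rcases no_all hP h.fB h' h.Bq h.Br with h | h | h <;> contradiction

lemma Yv.face {P : PlaneGraph V} (hP : IsFullerene P) {u p q r : V} {A B C : Finset (Sym2 V)}
    (h : Yv P u p q r A B C) {f : Finset (Sym2 V)} (hf : f ∈ P.faces) (hu : u ∈ edgeVerts f) :
    f = A ∨ f = B ∨ f = C := by
  refine three_faces hP h.fA h.fB h.fC hf (h.neAB hP) (h.rot.rot.neAB hP).symm (h.rot.neAB hP)
    (mem_edgeVerts.2 ⟨_, h.Ap⟩) (mem_edgeVerts.2 ⟨_, h.Bq⟩) (mem_edgeVerts.2 ⟨_, h.Cr⟩) hu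

lemma exists_Yv {P : PlaneGraph V} (hP : IsFullerene P) {u p q r : V} {A C : Finset (Sym2 V)}
    (hN : Nb P u p q r) (hA : A ∈ P.faces) (hC : C ∈ P.faces) (h1 : s(u, p) ∈ A)
    (h2 : s(u, q) ∈ A) (h3 : s(u, r) ∈ C) (h4 : s(u, p) ∈ C) : ∃ B, Yv P u p q r A B C := by
  obtain ⟨f, hf, hf1, hf2⟩ := corner_exists hP (face_adj hA h2) (face_adj hC h3) hN.2.2.1
  exact ⟨f, hN, hA, hf, hC, h1, h2, hf1, hf2, h3, h4⟩

/-- If `u` is matched to `p`, it leaves the opposite face. -/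
lemma Clar.leave {P : PlaneGraph V} (hP : IsFullerene P) {E : Finset (Sym2 V)}
    {H : Finset (Finset (Sym2 V))} {M : Finset (Sym2 V)} (hC : Clar P E H M)
    {u p q r : V} {A B C : Finset (Sym2 V)} (h : Yv P u p q r A B C) (hM : s(u, p) ∈ M) :
    Lv P E H M B u := by
  obtain ⟨f, hf⟩ := hC.F1 (mem_edgeVerts.2 ⟨_, hC.mE hM⟩) (hC.mC hM)
  rcases h.face hP hf.1 hf.2.2.2.1 with rfl | rfl | rfl
  · exact absurd h.Ap (hf.2.2.2.2.2 _ hM)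
  · exact hf
  · exact absurd h.Cp (hf.2.2.2.2.2 _ hM)

lemma Clar.unc {P : PlaneGraph V} (hP : IsFullerene P) {E : Finset (Sym2 V)}
    {H : Finset (Finset (Sym2 V))} {M : Finset (Sym2 V)} (hC : Clar P E H M)
    {u p q r : V} {A B C : Finset (Sym2 V)} (h : Yv P u p q r A B C)
    (hA : A ∉ H) (hB : B ∉ H) (hCC : C ∉ H) : u ∉ facesVerts H := by
  intro hu
  obtain ⟨f, hf, huf⟩ := mem_facesVerts.1 hu
  rcases h.face hP (hC.hex hf).1 huf with rfl | rfl | rfl <;> contradiction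

lemma Clar.notH {P : PlaneGraph V} {E : Finset (Sym2 V)}
    {H : Finset (Finset (Sym2 V))} {M : Finset (Sym2 V)} (hC : Clar P E H M)
    {A : Finset (Sym2 V)} (hA : A.card = 5) : A ∉ H := by
  intro h
  have := (hC.hex h).2
  omega

lemma Clar.tricho {P : PlaneGraph V} (hP : IsFullerene P) {E : Finset (Sym2 V)}
    {H : Finset (Finset (Sym2 V))} {M : Finset (Sym2 V)} (hC : Clar P E H M)
    {u p q r : V} {A B C : Finset (Sym2 V)} (h : Yv P u p q r A B C) (hu : u ∉ facesVerts H)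
    (hp : s(u, p) ∈ E) (hq : s(u, q) ∈ E) (hr : s(u, r) ∈ E) :
    (s(u, p) ∈ M ∧ Lv P E H M B u) ∨ (s(u, q) ∈ M ∧ Lv P E H M C u) ∨
      (s(u, r) ∈ M ∧ Lv P E H M A u) := by
  obtain ⟨w, hw⟩ := hC.deg3 h.nb hp hq hr hu
  rcases (h.nb.2.2.2 w).1 (hC.adj (hC.mE hw)) with rfl | rfl | rfl
  · exact Or.inl ⟨hw, hC.leave hP h hw⟩
  · exact Or.inr (Or.inl ⟨hw, hC.leave hP h.rot hw⟩)
  · exact Or.inr (Or.inr ⟨hw, hC.leave hP h.rot.rot hw⟩)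

/-! ### Symmetries of the ring data -/

lemma RD.shift {P : PlaneGraph V} {R : ZMod 6 → Finset (Sym2 V)} {a b e : ZMod 6 → V}
    {inn : ZMod 6 → Bool} (h : RD P R a b e inn) (k : ZMod 6) :
    RD P (fun i => R (i + k)) (fun i => a (i + k)) (fun i => b (i + k)) (fun i => e (i + k))
      (fun i => inn (i + k)) where
  face i := h.face _
  c5 i := h.c5 _
  inj h' := add_right_cancel (h.inj h')
  cycI hij hi := h.cycI (by rw [hij]; ring) hi
  cycO hij hi := h.cycO (by rw [hij]; ring) hi
  ainj h' := add_right_cancel (h.ainj h')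
  binj h' := add_right_cancel (h.binj h')
  einj h' := add_right_cancel (h.einj h')
  ab := h.ab
  ae := h.ae
  be := h.be

lemma RD.reflect {P : PlaneGraph V} {R : ZMod 6 → Finset (Sym2 V)} {a b e : ZMod 6 → V}
    {inn : ZMod 6 → Bool} (h : RD P R a b e inn) :
    RD P (fun i => R (-i)) (fun i => a (-i - 1)) (fun i => b (-i - 1)) (fun i => e (-i))
      (fun i => inn (-i)) where
  face i := h.face _
  c5 i := h.c5 _
  inj h' := neg_injective (h.inj h')
  cycI := by
    intro j i hij hi
    have h1 := h.cycI (j := -i - 1) (i := -i) (by ring) hi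
    have h2 : -j - 1 = -i := by rw [hij]; ring
    rw [h2]
    exact h1.refl.rot.rot.rot.rot
  cycO := by
    intro j i hij hi
    have h1 := h.cycO (j := -i - 1) (i := -i) (by ring) hi
    have h2 : -j - 1 = -i := by rw [hij]; ring
    rw [h2]
    exact h1.refl
  ainj h' := neg_injective (sub_left_injective (h.ainj h'))
  binj h' := neg_injective (sub_left_injective (h.binj h'))
  einj h' := neg_injective (h.einj h')
  ab := h.ab
  ae := h.ae
  be := h.be

lemma RD.comp {P : PlaneGraph V} {R : ZMod 6 → Finset (Sym2 V)} {a b e : ZMod 6 → V}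
    {inn : ZMod 6 → Bool} (h : RD P R a b e inn) : RD P R b a e (fun i => !(inn i)) where
  face i := h.face _
  c5 i := h.c5 _
  inj h' := h.inj h'
  cycI hij hi := (h.cycO hij (by simpa using hi)).refl.rot.rot
  cycO hij hi := (h.cycI hij (by simpa using hi)).refl.rot.rot
  ainj h' := h.binj h'
  binj h' := h.ainj h'
  einj h' := h.einj h'
  ab := h.ab.symm
  ae := h.be
  be := h.ae

/-- The eight canonical shapes. -/
def canon (f : ZMod 6 → Bool) : Bool :=
  (f 0, f 1, f 2, f 3, f 4, f 5) ∈ [(false, false, false, false, false, false),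
    (true, false, false, false, false, false), (true, true, false, false, false, false),
    (true, false, true, false, false, false), (false, false, true, false, false, true),
    (true, true, true, false, false, false), (true, true, false, true, false, false),
    (true, false, true, false, true, false)]

def vec6 (x0 x1 x2 x3 x4 x5 : Bool) (i : ZMod 6) : Bool :=
  if i = 0 then x0 else if i = 1 then x1 else if i = 2 then x2 else if i = 3 then x3
  else if i = 4 then x4 else x5

lemma exists_canon_aux : ∀ x0 x1 x2 x3 x4 x5 : Bool, ∃ k : ZMod 6, ∃ r c : Bool,
    canon (fun i => xor c (vec6 x0 x1 x2 x3 x4 x5 ((if r then -i else i) + k))) = true := by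
  decide +kernel

lemma exists_canon (f : ZMod 6 → Bool) : ∃ k : ZMod 6, ∃ r c : Bool,
    canon (fun i => xor c (f ((if r then -i else i) + k))) = true := by
  have hf : f = vec6 (f 0) (f 1) (f 2) (f 3) (f 4) (f 5) := by
    have hz : ∀ i : ZMod 6, i = 0 ∨ i = 1 ∨ i = 2 ∨ i = 3 ∨ i = 4 ∨ i = 5 := by decide
    have n10 : (1 : ZMod 6) ≠ 0 := by decide
    have n20 : (2 : ZMod 6) ≠ 0 := by decide
    have n21 : (2 : ZMod 6) ≠ 1 := by decide
    have n30 : (3 : ZMod 6) ≠ 0 := by decide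
    have n31 : (3 : ZMod 6) ≠ 1 := by decide
    have n32 : (3 : ZMod 6) ≠ 2 := by decide
    have n40 : (4 : ZMod 6) ≠ 0 := by decide
    have n41 : (4 : ZMod 6) ≠ 1 := by decide
    have n42 : (4 : ZMod 6) ≠ 2 := by decide
    have n43 : (4 : ZMod 6) ≠ 3 := by decide
    have n50 : (5 : ZMod 6) ≠ 0 := by decide
    have n51 : (5 : ZMod 6) ≠ 1 := by decide
    have n52 : (5 : ZMod 6) ≠ 2 := by decide
    have n53 : (5 : ZMod 6) ≠ 3 := by decide
    have n54 : (5 : ZMod 6) ≠ 4 := by decide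
    funext i
    rcases hz i with rfl | rfl | rfl | rfl | rfl | rfl <;>
      simp only [vec6, n10, n20, n21, n30, n31, n32, n40, n41, n42, n43, n50, n51, n52, n53, n54,
        if_true, if_false]
  rw [hf]
  exact exists_canon_aux _ _ _ _ _ _

lemma RD.canonical {P : PlaneGraph V} {R : ZMod 6 → Finset (Sym2 V)} {a b e : ZMod 6 → V}
    {inn : ZMod 6 → Bool} (h : RD P R a b e inn) {E : Finset (Sym2 V)} (hE : ∀ i, R i ⊆ E) :
    ∃ R a b e inn, RD P R a b e inn ∧ (∀ i, R i ⊆ E) ∧ canon inn = true := by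
  obtain ⟨k, r, c, hk⟩ := exists_canon inn
  cases r <;> cases c <;> simp only [Bool.false_eq_true, if_false, if_true] at hk
  · exact ⟨_, _, _, _, _, h.shift k, fun i => hE _, by simpa using hk⟩
  · exact ⟨_, _, _, _, _, (h.shift k).comp, fun i => hE _, by simpa using hk⟩
  · exact ⟨_, _, _, _, _, (h.shift k).reflect, fun i => hE _, by simpa using hk⟩
  · exact ⟨_, _, _, _, _, (h.shift k).reflect.comp, fun i => hE _, by simpa using hk⟩

/-! ### The inner faces of the ring -/

def lf (a e : ZMod 6 → V) (inn : ZMod 6 → Bool) (j i : ZMod 6) : V :=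
  if inn i = true then e i else a j

def rt (a e : ZMod 6 → V) (inn : ZMod 6 → Bool) (k : ZMod 6) : V :=
  if inn k = true then e k else a k

structure RT (P : PlaneGraph V) (R : ZMod 6 → Finset (Sym2 V)) (a b e : ZMod 6 → V)
    (inn : ZMod 6 → Bool) (T : ZMod 6 → Finset (Sym2 V)) (x : ZMod 6 → V) : Prop
    extends RD P R a b e inn where
  yA : ∀ {j i k}, i = j + 1 → k = i + 1 →
    Yv P (a i) (b i) (lf a e inn j i) (rt a e inn k) (R i) (T i) (R k)
  step : ∀ {i k}, k = i + 1 → inn k = false → T k = T i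
  yE : ∀ {j i}, i = j + 1 → inn i = true → Yv P (e i) (a j) (a i) (x i) (R i) (T i) (T j)

lemma RD.memE {P : PlaneGraph V} {R : ZMod 6 → Finset (Sym2 V)} {a b e : ZMod 6 → V}
    {inn : ZMod 6 → Bool} (h : RD P R a b e inn) {j i : ZMod 6} (hij : i = j + 1) :
    s(a i, b i) ∈ R i ∧ s(a j, b j) ∈ R i ∧ s(a i, lf a e inn j i) ∈ R i ∧
      s(a j, rt a e inn i) ∈ R i := by
  by_cases hi : inn i = true
  · have hm := (h.cycI hij hi).mem
    simp [lf, rt, hi, hm]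
  · have hi' : inn i = false := by simpa using hi
    have hm := (h.cycO hij hi').mem
    simp [lf, rt, hi', hm]

lemma RD.nbA {P : PlaneGraph V} (hP : IsFullerene P) {R : ZMod 6 → Finset (Sym2 V)}
    {a b e : ZMod 6 → V} {inn : ZMod 6 → Bool} (h : RD P R a b e inn) {j i k : ZMod 6}
    (hij : i = j + 1) (hik : k = i + 1) :
    Nb P (a i) (b i) (lf a e inn j i) (rt a e inn k) := by
  obtain ⟨h1, h2, h3, h4⟩ := h.memE hij
  obtain ⟨g1, g2, g3, g4⟩ := h.memE hik
  have n1 : i ≠ k := by rw [hik]; clear * -; revert i; decide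
  have n2 : j ≠ k := by rw [hik, hij]; clear * -; revert j; decide
  refine nb_of hP (face_adj (h.face i) h1) (face_adj (h.face i) h3) (face_adj (h.face k) g4)
    ?_ ?_ ?_
  · unfold lf; split_ifs
    · exact h.be
    · exact h.ab.symm
  · unfold rt; split_ifs
    · exact h.be
    · exact h.ab.symm
  · unfold lf rt; split_ifs
    · exact fun hh => n1 (h.einj hh)
    · exact h.ae.symm
    · exact h.ae
    · exact fun hh => n2 (h.ainj hh)

lemma RD.exists_rt {P : PlaneGraph V} (hP : IsFullerene P) {R : ZMod 6 → Finset (Sym2 V)}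
    {a b e : ZMod 6 → V} {inn : ZMod 6 → Bool} (h : RD P R a b e inn) :
    ∃ T x, RT P R a b e inn T x := by
  have hT : ∀ i, ∃ T, ∀ j k, i = j + 1 → k = i + 1 →
      Yv P (a i) (b i) (lf a e inn j i) (rt a e inn k) (R i) T (R k) := by
    intro i
    have hij : i = (i - 1) + 1 := by ring
    obtain ⟨h1, h2, h3, h4⟩ := h.memE hij
    obtain ⟨g1, g2, g3, g4⟩ := h.memE (j := i) (i := i + 1) rfl
    obtain ⟨T, hT⟩ := exists_Yv hP (h.nbA hP hij rfl) (h.face i) (h.face (i + 1)) h1 h3 g4 g2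
    refine ⟨T, ?_⟩
    intro j k hj hk
    have : j = i - 1 := by rw [hj]; ring
    subst this; subst hk; exact hT
  choose T hT using hT
  have hE : ∀ i, ∃ x, ∀ j, i = j + 1 → inn i = true →
      Yv P (e i) (a j) (a i) x (R i) (T i) (T j) := by
    intro i
    by_cases hi : inn i = true
    · have hij : i = (i - 1) + 1 := by ring
      suffices hs : ∀ j, i = j + 1 → ∃ x, Yv P (e i) (a j) (a i) x (R i) (T i) (T j) by
        obtain ⟨x, hx⟩ := hs _ hij
        refine ⟨x, ?_⟩
        intro j hj _
        have : j = i - 1 := by rw [hj]; ring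
        subst this; exact hx
      clear hij
      intro j hij
      have hm := (h.cycI hij hi).mem
      have m1 : s(e i, a j) ∈ R i := by simp [hm]
      have m2 : s(e i, a i) ∈ R i := by simp [hm]
      have nji : a j ≠ a i := (h.cycI hij hi).1.2.1
      obtain ⟨x, hN⟩ := exists_third hP (face_adj (h.face i) m1) (face_adj (h.face i) m2) nji
      have Y1 := hT i j (i + 1) hij rfl
      have Y0 := hT j (j - 1) i (by ring) hij
      simp only [lf, hi, if_true] at Y1
      simp only [rt, hi, if_true] at Y0
      have t1 : s(e i, a i) ∈ T i := sw Y1.Bq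
      have t0 : s(e i, a j) ∈ T j := sw Y0.Br
      refine ⟨x, hN, h.face i, Y1.fB, Y0.fB, m1, m2, t1, ?_, ?_, t0⟩
      · exact face_step hP Y1.fB (h.face i) (Y1.neAB hP).symm
          (nb_swap (nb_rot hN)) t1 m2 m1
      · exact face_step hP Y0.fB (h.face i) (Y0.rot.neAB hP) hN t0 m1 m2
    · exact ⟨a i, fun j _ h' => absurd h' hi⟩
  choose x hx using hE
  refine ⟨T, x, h, fun {j i k} h1 h2 => hT i j k h1 h2, ?_, fun {j i} h1 h2 => hx i j h1 h2⟩
  intro i k hik hk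
  have Y0 := hT i (i - 1) k (by ring) hik
  have Y1 := hT k i (k + 1) hik rfl
  simp only [rt, hk, Bool.false_eq_true, if_false] at Y0
  simp only [lf, hk, Bool.false_eq_true, if_false] at Y1
  rcases no_three Y1.fB Y0.fB (h.face k) Y1.Bq (sw Y0.Br) Y1.Aq with hh | hh | hh
  · exact hh
  · exact absurd hh.symm (Y1.neAB hP)
  · exact absurd hh (Y0.rot.neAB hP)

set_option linter.unusedSectionVars false

/-! ### The geometrically impossible shapes -/

section shapes

variable {P : PlaneGraph V} {R : ZMod 6 → Finset (Sym2 V)} {a b e : ZMod 6 → V}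
  {inn : ZMod 6 → Bool} {T : ZMod 6 → Finset (Sym2 V)} {x : ZMod 6 → V}

lemma RD.na (h : RD P R a b e inn) {i j : ZMod 6} (hij : i ≠ j) : a i ≠ a j :=
  fun hh => hij (h.ainj hh)

lemma RD.nb' (h : RD P R a b e inn) {i j : ZMod 6} (hij : i ≠ j) : b i ≠ b j :=
  fun hh => hij (h.binj hh)

lemma RD.ne' (h : RD P R a b e inn) {i j : ZMod 6} (hij : i ≠ j) : e i ≠ e j :=
  fun hh => hij (h.einj hh)

lemma RT.l_in (h : RT P R a b e inn T x) {i : ZMod 6} (hi : inn i = true) :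
    s(e i, a i) ∈ T i := by
  have := h.yA (j := i - 1) (i := i) (k := i + 1) (by ring) rfl
  simp only [lf, hi, if_true] at this
  exact sw this.Bq

lemma RT.r_in (h : RT P R a b e inn T x) {i k : ZMod 6} (hk : k = i + 1) (hi : inn k = true) :
    s(a i, e k) ∈ T i := by
  have := h.yA (j := i - 1) (i := i) (k := k) (by ring) hk
  simp only [rt, hi, if_true] at this
  exact this.Br

lemma RT.r_out (h : RT P R a b e inn T x) {i k : ZMod 6} (hk : k = i + 1) (hi : inn k = false) :
    s(a i, a k) ∈ T i := by
  have := h.yA (j := i - 1) (i := i) (k := k) (by ring) hk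
  simp only [rt, hi, Bool.false_eq_true, if_false] at this
  exact this.Br

lemma Yv.memB (hP : IsFullerene P) {u p q r t : V} {A B C : Finset (Sym2 V)}
    (h : Yv P u p q r A B C) (ht : s(u, t) ∈ B) : t = q ∨ t = r := by
  rcases no_all hP h.fB h.Bq h.Br ht with h' | h' | h'
  · exact absurd h' h.nb.2.2.1
  · exact Or.inl h'.symm
  · exact Or.inr h'.symm

lemma no4 (hP : IsFullerene P) {f : Finset (Sym2 V)} (hf : f ∈ P.faces) {a b c d : V}
    (h1 : s(a, b) ∈ f) (h2 : s(b, c) ∈ f) (h3 : s(c, d) ∈ f) (h4 : s(d, a) ∈ f)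
    (hac : a ≠ c) (hbd : b ≠ d) : False := by
  rcases path4 hP hf h1 h2 h3 hac hbd with ⟨-, y, hc⟩ | ⟨-, y, z, hc⟩
  · have hm := (hc.mem _ _).1 h4
    obtain ⟨⟨d1, d2, d3, d4, d5, d6, d7, d8, d9, d10⟩, -⟩ := hc
    clear * - hm d1 d2 d3 d4 d5 d6 d7 d8 d9 d10
    grind
  · have hm := (hc.mem _ _).1 h4
    obtain ⟨⟨d1, d2, d3, d4, d5, d6, d7, d8, d9, d10, d11, d12, d13, d14, d15⟩, -⟩ := hc
    clear * - hm d1 d2 d3 d4 d5 d6 d7 d8 d9 d10 d11 d12 d13 d14 d15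
    grind

lemma no3 (hP : IsFullerene P) {f : Finset (Sym2 V)} (hf : f ∈ P.faces) {a b c : V}
    (h1 : s(a, b) ∈ f) (h2 : s(b, c) ∈ f) (h3 : s(c, a) ∈ f) (hac : a ≠ c) : False := by
  rcases path3 hP hf h1 h2 hac with ⟨-, x, y, hc⟩ | ⟨-, x, y, z, hc⟩
  · have hm := (hc.mem _ _).1 h3
    obtain ⟨⟨d1, d2, d3, d4, d5, d6, d7, d8, d9, d10⟩, -⟩ := hc
    clear * - hm d1 d2 d3 d4 d5 d6 d7 d8 d9 d10
    grind
  · have hm := (hc.mem _ _).1 h3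
    obtain ⟨⟨d1, d2, d3, d4, d5, d6, d7, d8, d9, d10, d11, d12, d13, d14, d15⟩, -⟩ := hc
    clear * - hm d1 d2 d3 d4 d5 d6 d7 d8 d9 d10 d11 d12 d13 d14 d15
    grind

lemma case1 (hP : IsFullerene P) (h : RT P R a b e inn T x) (h0 : inn 0 = true)
    (h1 : inn 1 = false) (h2 : inn 2 = false) (h3 : inn 3 = false) (h4 : inn 4 = false)
    (h5 : inn 5 = false) : False := by
  have s1 := h.step (i := 0) (by decide) h1
  have s2 := h.step (i := 1) (by decide) h2
  have s3 := h.step (i := 2) (by decide) h3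
  have s4 := h.step (i := 3) (by decide) h4
  have p0 := h.l_in h0
  have p1 := h.r_out (i := 0) (by decide) h1
  have p2 := h.r_out (i := 1) (by decide) h2
  have p3 := h.r_out (i := 2) (by decide) h3
  have p4 := h.r_out (i := 3) (by decide) h4
  have p5 := h.r_out (i := 4) (by decide) h5
  rw [s4] at p5
  rw [s3] at p4 p5
  rw [s2] at p3 p4 p5
  rw [s1] at p2 p3 p4 p5
  have hf := (h.yE (j := 5) (i := 0) (by decide) h0).fB
  obtain ⟨-, hc⟩ := path6 hP hf p0 p1 p2 p3 p4 h.ae.symm (h.na (by decide)) (h.na (by decide))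
    (h.na (by decide)) h.ae.symm
  have hm := (hc.verts (a 5)).1 (mem_edgeVerts.2 ⟨_, sw p5⟩)
  rcases hm with hm | hm | hm | hm | hm | hm
  · exact h.ae hm
  all_goals exact absurd (h.ainj hm) (by decide)

lemma case2 (hP : IsFullerene P) (h : RT P R a b e inn T x) (h0 : inn 0 = true)
    (h1 : inn 1 = true) (h2 : inn 2 = false) (h3 : inn 3 = false) (h4 : inn 4 = false)
    (h5 : inn 5 = false) : False := by
  have s2 := h.step (i := 1) (by decide) h2
  have s3 := h.step (i := 2) (by decide) h3
  have s4 := h.step (i := 3) (by decide) h4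
  have s5 := h.step (i := 4) (by decide) h5
  have p1 := h.l_in h1
  have p2 := h.r_out (i := 1) (by decide) h2
  have p3 := h.r_out (i := 2) (by decide) h3
  have p4 := h.r_out (i := 3) (by decide) h4
  have p5 := h.r_out (i := 4) (by decide) h5
  have p6 := h.r_in (i := 5) (by decide) h0
  rw [s5] at p6
  rw [s4] at p5 p6
  rw [s3] at p4 p5 p6
  rw [s2] at p3 p4 p5 p6
  have hf := (h.yE (j := 0) (i := 1) (by decide) h1).fB
  obtain ⟨-, hc⟩ := path6 hP hf p1 p2 p3 p4 p5 h.ae.symm (h.na (by decide)) (h.na (by decide))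
    (h.na (by decide)) h.ae.symm
  have hm := (hc.verts (e 0)).1 (mem_edgeVerts.2 ⟨_, sw p6⟩)
  rcases hm with hm | hm | hm | hm | hm | hm
  · exact absurd (h.einj hm) (by decide)
  all_goals exact h.ae hm.symm

lemma case3 (hP : IsFullerene P) (h : RT P R a b e inn T x) (h0 : inn 0 = true)
    (h1 : inn 1 = false) (h2 : inn 2 = true) (h3 : inn 3 = false) (h4 : inn 4 = false)
    (h5 : inn 5 = false) : False := by
  have s1 := h.step (i := 0) (by decide) h1
  have s3 := h.step (i := 2) (by decide) h3
  have s4 := h.step (i := 3) (by decide) h4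
  have s5 := h.step (i := 4) (by decide) h5
  have p0 := h.l_in h0
  have p1 := h.r_out (i := 0) (by decide) h1
  have p2 := h.r_in (i := 1) (by decide) h2
  have q2 := h.l_in h2
  have q3 := h.r_out (i := 2) (by decide) h3
  have q4 := h.r_out (i := 3) (by decide) h4
  have q5 := h.r_out (i := 4) (by decide) h5
  have q6 := h.r_in (i := 5) (by decide) h0
  rw [s5] at q6
  rw [s4] at q5 q6
  rw [s3] at q4 q5 q6
  rw [s1] at p2
  have Y2 := h.yE (j := 1) (i := 2) (by decide) h2
  have Y0 := h.yE (j := 5) (i := 0) (by decide) h0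
  rw [s1] at Y2
  obtain ⟨-, hc⟩ := path6 hP Y2.fB q2 q3 q4 q5 q6 h.ae.symm (h.na (by decide)) (h.na (by decide))
    h.ae (h.ne' (by decide))
  have hm : s(e 2, e 0) ∈ T 2 := by simp [hc.mem]
  have hx : e 0 = x 2 := by
    rcases Y2.memB hP hm with hh | hh
    · exact absurd hh h.ae.symm
    · exact hh
  have hm2 := Y2.Cr
  rw [← hx] at hm2
  exact no4 hP Y0.fB p0 p1 p2 hm2 h.ae.symm h.ae

lemma case5 (hP : IsFullerene P) (h : RT P R a b e inn T x) (h0 : inn 0 = true)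
    (h1 : inn 1 = true) (h2 : inn 2 = true) (h3 : inn 3 = false) (h4 : inn 4 = false)
    (h5 : inn 5 = false) : False := by
  have s3 := h.step (i := 2) (by decide) h3
  have s4 := h.step (i := 3) (by decide) h4
  have s5 := h.step (i := 4) (by decide) h5
  have q2 := h.l_in h2
  have q3 := h.r_out (i := 2) (by decide) h3
  have q4 := h.r_out (i := 3) (by decide) h4
  have q5 := h.r_out (i := 4) (by decide) h5
  have q6 := h.r_in (i := 5) (by decide) h0
  rw [s5] at q6
  rw [s4] at q5 q6
  rw [s3] at q4 q5 q6
  have Y2 := h.yE (j := 1) (i := 2) (by decide) h2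
  have Y1 := h.yE (j := 0) (i := 1) (by decide) h1
  have Y0 := h.yE (j := 5) (i := 0) (by decide) h0
  rw [s5, s4, s3] at Y0
  obtain ⟨-, hc⟩ := path6 hP Y2.fB q2 q3 q4 q5 q6 h.ae.symm (h.na (by decide)) (h.na (by decide))
    h.ae (h.ne' (by decide))
  have hm : s(e 2, e 0) ∈ T 2 := by simp [hc.mem]
  have hx : e 0 = x 2 := by
    rcases Y2.memB hP hm with hh | hh
    · exact absurd hh h.ae.symm
    · exact hh
  have hx0 : e 2 = x 0 := by
    rcases Y0.rot.memB hP (sw hm) with hh | hh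
    · exact hh
    · exact absurd hh h.ae.symm
  have m0 := Y0.Br
  rw [← hx0] at m0
  have m1 := Y2.Cr
  rw [← hx] at m1
  rcases no_three Y0.fB Y1.fB Y2.fB m0 (sw m1) (sw hm) with hh | hh | hh
  · exact Y1.rot.neAB hP hh.symm
  · exact Y0.rot.neAB hP hh
  · exact Y2.rot.neAB hP hh.symm

lemma case6 (hP : IsFullerene P) (h : RT P R a b e inn T x) (h0 : inn 0 = true)
    (h1 : inn 1 = true) (h2 : inn 2 = false) (h3 : inn 3 = true) (h4 : inn 4 = false)
    (h5 : inn 5 = false) : False := by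
  have s2 := h.step (i := 1) (by decide) h2
  have s4 := h.step (i := 3) (by decide) h4
  have s5 := h.step (i := 4) (by decide) h5
  have Y0 := h.yE (j := 5) (i := 0) (by decide) h0
  have Y1 := h.yE (j := 0) (i := 1) (by decide) h1
  have Y3 := h.yE (j := 2) (i := 3) (by decide) h3
  rw [s5, s4] at Y0
  rw [s2] at Y3
  have n01 := (Y1.rot.neAB hP).symm
  have n03 := Y0.rot.neAB hP
  have n31 := Y3.rot.neAB hP
  have q3 := h.l_in h3
  have q4 := h.r_out (i := 3) (by decide) h4
  have q5 := h.r_out (i := 4) (by decide) h5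
  have q6 := h.r_in (i := 5) (by decide) h0
  rw [s5] at q6
  rw [s4] at q5 q6
  have p0 := h.l_in h0
  have p1 := h.r_in (i := 0) (by decide) h1
  have r1 := h.l_in h1
  have r2 := h.r_out (i := 1) (by decide) h2
  have r3 := h.r_in (i := 2) (by decide) h3
  rw [s2] at r3
  rcases path5 hP Y3.fB q3 q4 q5 q6 h.ae.symm (h.na (by decide)) h.ae with ⟨-, hc⟩ | ⟨-, z, hc⟩
  · have hm : s(e 3, e 0) ∈ T 3 := by simp [hc.mem]
    have hx : e 0 = x 3 := by
      rcases Y3.memB hP hm with hh | hh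
      · exact absurd hh h.ae.symm
      · exact hh
    have hx0 : e 3 = x 0 := by
      rcases Y0.rot.memB hP (sw hm) with hh | hh
      · exact hh
      · exact absurd hh h.ae.symm
    have m0 := Y0.Br
    rw [← hx0] at m0
    have m1 := Y3.Cr
    rw [← hx] at m1
    rcases no_three Y0.fB Y1.fB Y3.fB m0 (sw m1) (sw hm) with hh | hh | hh
    · exact n01 hh
    · exact n03 hh
    · exact n31 hh.symm
  · have m1 : s(e 3, z) ∈ T 3 := by simp [hc.mem]
    have m2 : s(e 0, z) ∈ T 3 := by simp [hc.mem]
    have hz3 : z = x 3 := by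
      rcases Y3.memB hP m1 with hh | hh
      · exact absurd hh.symm hc.1.2.2.2.2.2.2.2.2.1
      · exact hh
    have hz0 : z = x 0 := by
      rcases Y0.rot.memB hP m2 with hh | hh
      · exact hh
      · exact absurd hh.symm hc.1.2.2.2.2.2.2.2.2.2.2.2.2.2.1
    have t0 := Y0.Br
    rw [← hz0] at t0
    have t3 := Y3.Cr
    rw [← hz3] at t3
    have nza0 : z ≠ a 0 := by rw [hz0]; exact Y0.nb.2.2.1.symm
    have nza2 : a 2 ≠ z := by rw [hz3]; exact Y3.nb.2.1
    rcases path5 hP Y1.fB r1 r2 r3 t3 h.ae.symm h.ae nza2 with ⟨-, hd⟩ | ⟨-, y, hd⟩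
    · have m3 : s(e 1, z) ∈ T 1 := by simp [hd.mem]
      have hz1 : z = x 1 := by
        rcases Y1.memB hP m3 with hh | hh
        · exact absurd hh.symm hd.1.2.2.2.2.2.2.1
        · exact hh
      have m4 := Y1.Cr
      rw [← hz1] at m4
      exact no4 hP Y0.fB (sw t0) p0 p1 m4 nza0 (h.ne' (by decide))
    · have m3 : s(e 1, y) ∈ T 1 := by simp [hd.mem]
      have hy1 : y = x 1 := by
        rcases Y1.memB hP m3 with hh | hh
        · exact absurd hh.symm hd.1.2.2.2.2.2.2.2.2.1
        · exact hh
      have m4 := Y1.Cr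
      rw [← hy1] at m4
      have na0y : a 0 ≠ y := by rw [hy1]; exact Y1.nb.2.1
      have m5 : s(y, z) ∈ T 1 := by simp [hd.mem]
      have ne1z : e 1 ≠ z := hd.1.2.2.2.1
      have nyz : z ≠ y := hd.1.2.2.2.2.2.2.2.2.2.2.2.2.2.2
      have ny3 : e 3 ≠ y := hd.1.2.2.2.2.2.2.2.2.2.2.2.2.2.1
      rcases path5 hP Y0.fB (sw t0) p0 p1 m4 nza0 (h.ne' (by decide)) na0y with
        ⟨-, hg⟩ | ⟨-, w, hg⟩
      · have m6 : s(y, z) ∈ T 0 := by simp [hg.mem]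
        exact n01 (corner_unique hP Y0.fB Y1.fB ne1z (sw m4) m6 (sw m3) m5)
      · have m6 : s(z, w) ∈ T 0 := by simp [hg.mem]
        have ne0y : e 0 ≠ y := hg.1.2.2.2.2.2.2.2.1
        have nwy : y ≠ w := hg.1.2.2.2.2.2.2.2.2.2.2.2.2.2.2
        have nwe : e 0 ≠ w := hg.1.2.2.2.2.2.2.2.2.1
        have hN := nb_of hP (face_adj Y0.fB (sw t0)) (face_adj Y1.fB (sw t3))
          (face_adj Y1.fB (sw m5)) (h.ne' (by decide)) ne0y ny3
        rcases (hN.2.2.2 w).1 (face_adj Y0.fB m6) with hh | hh | hh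
        · exact nwe hh.symm
        · subst hh
          exact n03 (corner_unique hP Y0.fB Y3.fB (h.ne' (by decide : (0 : ZMod 6) ≠ 3))
            (sw t0) m6 (sw m2) (sw m1))
        · exact nwy hh.symm

end shapes

set_option linter.unusedSectionVars false

/-! ### The shapes with pentagons inside the ring -/

section shapes2

variable {P : PlaneGraph V} {R : ZMod 6 → Finset (Sym2 V)} {a b e : ZMod 6 → V}
  {inn : ZMod 6 → Bool} {T : ZMod 6 → Finset (Sym2 V)} {x : ZMod 6 → V}
  {E : Finset (Sym2 V)} {H : Finset (Finset (Sym2 V))} {M : Finset (Sym2 V)}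

lemma case4_aux (hP : IsFullerene P) (h : RT P R a b e inn T x) (h0 : inn 0 = false)
    (h1 : inn 1 = false) (h2 : inn 2 = true) (h3 : inn 3 = false) (h4 : inn 4 = false)
    (h5 : inn 5 = true) : (T 2).card = 5 ∧ (T 5).card = 5 ∧ x 2 = e 5 ∧ x 5 = e 2 := by
  have s3 := h.step (i := 2) (by decide) h3
  have s4 := h.step (i := 3) (by decide) h4
  have s0 := h.step (i := 5) (by decide) h0
  have s1 := h.step (i := 0) (by decide) h1
  have Y2 := h.yE (j := 1) (i := 2) (by decide) h2
  have Y5 := h.yE (j := 4) (i := 5) (by decide) h5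
  rw [s1, s0] at Y2
  rw [s4, s3] at Y5
  have q2 := h.l_in h2
  have q3 := h.r_out (i := 2) (by decide) h3
  have q4 := h.r_out (i := 3) (by decide) h4
  have q5 := h.r_in (i := 4) (by decide) h5
  rw [s4] at q5
  rw [s3] at q4 q5
  have p5 := h.l_in h5
  have p0 := h.r_out (i := 5) (by decide) h0
  have p1 := h.r_out (i := 0) (by decide) h1
  have p2 := h.r_in (i := 1) (by decide) h2
  rw [s1] at p2
  rw [s0] at p1 p2
  have nT := Y2.rot.neAB hP
  have n25 : e 2 ≠ e 5 := h.ne' (by decide)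
  rcases path5 hP Y2.fB q2 q3 q4 q5 h.ae.symm (h.na (by decide)) h.ae with ⟨c2, hc⟩ | ⟨-, z, hc⟩
  · rcases path5 hP Y5.fB p5 p0 p1 p2 h.ae.symm (h.na (by decide)) h.ae with
      ⟨c5, hd⟩ | ⟨-, z, hd⟩
    · refine ⟨c2, c5, ?_, ?_⟩
      · have m : s(e 2, e 5) ∈ T 2 := by simp [hc.mem]
        rcases Y2.memB hP m with hh | hh
        · exact absurd hh h.ae.symm
        · exact hh.symm
      · have m : s(e 5, e 2) ∈ T 5 := by simp [hd.mem]
        rcases Y5.memB hP m with hh | hh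
        · exact absurd hh h.ae.symm
        · exact hh.symm
    · exfalso
      have m1 : s(e 5, z) ∈ T 5 := by simp [hd.mem]
      have m2 : s(e 2, z) ∈ T 5 := by simp [hd.mem]
      have hz5 : z = x 5 := by
        rcases Y5.memB hP m1 with hh | hh
        · exact absurd hh.symm hd.1.2.2.2.2.2.2.2.2.1
        · exact hh
      have hz2 : z = x 2 := by
        rcases Y2.rot.memB hP m2 with hh | hh
        · exact hh
        · exact absurd hh.symm hd.1.2.2.2.2.2.2.2.2.2.2.2.2.2.1
      have m3 := Y2.Br
      rw [← hz2] at m3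
      have m4 := Y5.Cr
      rw [← hz5] at m4
      exact nT (corner_unique hP Y2.fB Y5.fB n25 (sw m3) (sw m4) (sw m2) (sw m1))
  · exfalso
    have m1 : s(e 2, z) ∈ T 2 := by simp [hc.mem]
    have m2 : s(e 5, z) ∈ T 2 := by simp [hc.mem]
    have hz2 : z = x 2 := by
      rcases Y2.memB hP m1 with hh | hh
      · exact absurd hh.symm hc.1.2.2.2.2.2.2.2.2.1
      · exact hh
    have hz5 : z = x 5 := by
      rcases Y5.rot.memB hP m2 with hh | hh
      · exact hh
      · exact absurd hh.symm hc.1.2.2.2.2.2.2.2.2.2.2.2.2.2.1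
    have m3 := Y2.Cr
    rw [← hz2] at m3
    have m4 := Y5.Br
    rw [← hz5] at m4
    exact nT (corner_unique hP Y2.fB Y5.fB n25 (sw m1) (sw m2) (sw m3) (sw m4))

/-- All three edges at an inner ring vertex belong to `G`. -/
lemma RT.triA (hP : IsFullerene P) (h : RT P R a b e inn T x) (hC : Clar P E H M)
    (hE : ∀ i, R i ⊆ E) {j i k : ZMod 6} (hij : i = j + 1) (hik : k = i + 1)
    (hu : a i ∉ facesVerts H) :
    (s(a i, b i) ∈ M ∧ Lv P E H M (T i) (a i)) ∨
    (s(a i, lf a e inn j i) ∈ M ∧ Lv P E H M (R k) (a i)) ∨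
      (s(a i, rt a e inn k) ∈ M ∧ Lv P E H M (R i) (a i)) := by
  have Y := h.yA hij hik
  exact hC.tricho hP Y hu (hE _ Y.Ap) (hE _ Y.Aq) (hE _ Y.Cr)

lemma RT.uncA (hP : IsFullerene P) (h : RT P R a b e inn T x) (hC : Clar P E H M)
    {i : ZMod 6} (hT : T i ∉ H) : a i ∉ facesVerts H :=
  hC.unc hP (h.yA (j := i - 1) (i := i) (k := i + 1) (by ring) rfl) (hC.notH (h.c5 _)) hT
    (hC.notH (h.c5 _))

lemma case4 (hP : IsFullerene P) (h : RT P R a b e inn T x) (hC : Clar P E H M)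
    (hE : ∀ i, R i ⊆ E) (h0 : inn 0 = false)
    (h1 : inn 1 = false) (h2 : inn 2 = true) (h3 : inn 3 = false) (h4 : inn 4 = false)
    (h5 : inn 5 = true) : False := by
  obtain ⟨c2, c5, x2, x5⟩ := case4_aux hP h h0 h1 h2 h3 h4 h5
  have s3 := h.step (i := 2) (by decide) h3
  have s4 := h.step (i := 3) (by decide) h4
  have s0 := h.step (i := 5) (by decide) h0
  have s1 := h.step (i := 0) (by decide) h1
  rw [s3] at s4
  rw [s0] at s1
  have Y2 := h.yE (j := 1) (i := 2) (by decide) h2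
  have Y5 := h.yE (j := 4) (i := 5) (by decide) h5
  rw [s1, x2] at Y2
  rw [s4, x5] at Y5
  have nH2 := hC.notH c2
  have nH5 := hC.notH c5
  have ue2 := hC.unc hP Y2 (hC.notH (h.c5 _)) nH2 nH5
  have ue5 := hC.unc hP Y5 (hC.notH (h.c5 _)) nH5 nH2
  have ua1 := h.uncA hP hC (i := 1) (by rw [s1]; exact nH5)
  have A1 := h.triA hP hC hE (j := 0) (i := 1) (k := 2) (by decide) (by decide) ua1
  have A2 := h.triA hP hC hE (j := 1) (i := 2) (k := 3) (by decide) (by decide)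
    (h.uncA hP hC nH2)
  have A5 := h.triA hP hC hE (j := 4) (i := 5) (k := 0) (by decide) (by decide)
    (h.uncA hP hC nH5)
  have Y3 := h.yA (j := 2) (i := 3) (k := 4) (by decide) (by decide)
  have Y4 := h.yA (j := 3) (i := 4) (k := 5) (by decide) (by decide)
  have YA5 := h.yA (j := 4) (i := 5) (k := 0) (by decide) (by decide)
  have Y0 := h.yA (j := 5) (i := 0) (k := 1) (by decide) (by decide)
  simp only [lf, rt, h0, h1, h2, h3, h4, h5, s1, if_true, if_false, Bool.false_eq_true]
    at A1 A2 A5 Y3 Y4 YA5 Y0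
  have n25 : e 2 ≠ e 5 := h.ne' (by decide)
  by_cases hch : s(e 2, e 5) ∈ E
  · have B2 := hC.tricho hP Y2 ue2 (hE _ Y2.Ap) (hE _ Y2.Aq) hch
    have B5 := hC.tricho hP Y5 ue5 (hE _ Y5.Ap) (hE _ Y5.Aq) (sw hch)
    rcases B2 with ⟨m, l⟩ | ⟨m, l⟩ | ⟨m, l⟩
    · rcases B5 with ⟨m', l'⟩ | ⟨m', l'⟩ | ⟨m', l'⟩
      · have l4 := hC.leave hP Y4.rot.rot (sw m')
        rcases A2 with ⟨m3, l3⟩ | ⟨m3, l3⟩ | ⟨m3, l3⟩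
        · exact h.ae (hC.F2 l3 l)
        · exact h.na (by decide) (hC.mU m (sw m3))
        · have l5 := hC.leave hP Y3.rot (sw m3)
          exact h.na (by decide) (hC.F2 l4 l5)
      · exact n25 (hC.F2 l l')
      · exact h.ae (hC.mU m (sw m'))
    · rcases B5 with ⟨m', l'⟩ | ⟨m', l'⟩ | ⟨m', l'⟩
      · exact n25 (hC.F2 l l')
      · have l4 := hC.leave hP YA5.rot (sw m')
        rcases A1 with ⟨m3, l3⟩ | ⟨m3, l3⟩ | ⟨m3, l3⟩
        · exact h.ae (hC.F2 l3 l)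
        · have l5 := hC.leave hP Y0.rot.rot (sw m3)
          exact h.na (by decide) (hC.F2 l4 l5)
        · exact h.na (by decide) (hC.mU m (sw m3))
      · exact h.ae (hC.mU m (sw m'))
    · have l' := hC.leave hP Y5.rot.rot (sw m)
      rcases A1 with ⟨m3, l3⟩ | ⟨m3, l3⟩ | ⟨m3, l3⟩
      · rcases A5 with ⟨m4, l4⟩ | ⟨m4, l4⟩ | ⟨m4, l4⟩
        · exact h.na (by decide) (hC.F2 l3 l4)
        · exact h.ae (hC.mU (sw m4) (sw m))
        · exact h.ae (hC.F2 l4 l')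
      · exact h.ae (hC.F2 l3 l)
      · exact h.ae (hC.mU (sw m3) m)
  · obtain ⟨p, hp⟩ := hC.F1 (mem_edgeVerts.2 ⟨_, hE _ Y2.Ap⟩) ue2
    have hp2 : p = R 2 := by
      rcases Y2.face hP hp.1 hp.2.2.2.1 with hh | hh | hh
      · exact hh
      · subst hh; exact absurd (hp.2.2.1 Y2.Br) hch
      · subst hh; exact absurd (hp.2.2.1 Y2.Cr) hch
    subst hp2
    rcases A1 with ⟨m3, l3⟩ | ⟨m3, l3⟩ | ⟨m3, l3⟩
    · exact hch (l3.2.2.1 Y2.Cr)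
    · exact h.ae (hC.F2 l3 hp)
    · exact hp.2.2.2.2.2 _ (sw m3) Y2.Ap

/-- A gap of length two: the inner face closes up as a pentagon or as a hexagon. -/
lemma gap2 (hP : IsFullerene P) {f A B C D : Finset (Sym2 V)} {e0 a0 a1 e2 x0 x2 p q : V}
    (Y0 : Yv P e0 p a0 x0 A f C) (Y2 : Yv P e2 a1 q x2 B D f) (h1 : s(a0, a1) ∈ f)
    (h01 : e0 ≠ a1) (h02 : a0 ≠ e2) :
    (f.card = 5 ∧ x0 = x2 ∧ Cyc5 f e0 a0 a1 e2 x0) ∨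
      (x0 ≠ x2 ∧ Cyc6 f e0 a0 a1 e2 x2 x0) := by
  rcases path4 hP Y0.fB Y0.Bq h1 (sw Y2.Cp) h01 h02 with ⟨c, y, hc⟩ | ⟨c, y, z, hc⟩
  · left
    have m1 : s(e0, y) ∈ f := by simp [hc.mem]
    have m2 : s(e2, y) ∈ f := by simp [hc.mem]
    have hy0 : y = x0 := by
      rcases Y0.memB hP m1 with hh | hh
      · exact absurd hh.symm hc.1.2.2.2.2.2.2.1
      · exact hh
    have hy2 : y = x2 := by
      rcases Y2.rot.memB hP m2 with hh | hh
      · exact hh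
      · exact absurd hh.symm hc.1.2.2.2.2.2.2.2.2.1
    exact ⟨c, hy0.symm.trans hy2, hy0 ▸ hc⟩
  · right
    have m1 : s(e0, z) ∈ f := by simp [hc.mem]
    have m2 : s(e2, y) ∈ f := by simp [hc.mem]
    have hz0 : z = x0 := by
      rcases Y0.memB hP m1 with hh | hh
      · exact absurd hh.symm hc.1.2.2.2.2.2.2.2.2.1
      · exact hh
    have hy2 : y = x2 := by
      rcases Y2.rot.memB hP m2 with hh | hh
      · exact hh
      · exact absurd hh.symm hc.1.2.2.2.2.2.2.2.2.2.2.1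
    subst hz0; subst hy2
    exact ⟨hc.1.2.2.2.2.2.2.2.2.2.2.2.2.2.2.symm, hc⟩

lemma case7_aux (hP : IsFullerene P) (h : RT P R a b e inn T x) (h0 : inn 0 = true)
    (h1 : inn 1 = false) (h2 : inn 2 = true) (h3 : inn 3 = false) (h4 : inn 4 = true)
    (h5 : inn 5 = false) : x 0 = x 2 ∧ x 2 = x 4 ∧ (T 0).card = 5 ∧ (T 2).card = 5 ∧
      (T 4).card = 5 ∧ Cyc5 (T 0) (e 0) (a 0) (a 1) (e 2) (x 0) ∧
      Cyc5 (T 2) (e 2) (a 2) (a 3) (e 4) (x 2) ∧ Cyc5 (T 4) (e 4) (a 4) (a 5) (e 0) (x 4) := by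
  have s1 := h.step (i := 0) (by decide) h1
  have s3 := h.step (i := 2) (by decide) h3
  have s5 := h.step (i := 4) (by decide) h5
  have Y0 := h.yE (j := 5) (i := 0) (by decide) h0
  have Y2 := h.yE (j := 1) (i := 2) (by decide) h2
  have Y4 := h.yE (j := 3) (i := 4) (by decide) h4
  rw [s5] at Y0
  rw [s1] at Y2
  rw [s3] at Y4
  have G0 := gap2 hP Y0 Y2 (h.r_out (i := 0) (by decide) h1) h.ae.symm h.ae
  have G2 := gap2 hP Y2 Y4 (h.r_out (i := 2) (by decide) h3) h.ae.symm h.ae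
  have G4 := gap2 hP Y4 Y0 (h.r_out (i := 4) (by decide) h5) h.ae.symm h.ae
  have n04 := Y0.rot.neAB hP
  have n20 := Y2.rot.neAB hP
  have n42 := Y4.rot.neAB hP
  rcases G0 with ⟨c0, e0, g0⟩ | ⟨e0, g0⟩
  · rcases G2 with ⟨c2, e2, g2⟩ | ⟨e2, g2⟩
    · rcases G4 with ⟨c4, e4, g4⟩ | ⟨e4, g4⟩
      · exact ⟨e0, e2, c0, c2, c4, g0, g2, g4⟩
      · exact absurd (e2.symm.trans e0.symm) e4
    · rcases G4 with ⟨c4, e4, g4⟩ | ⟨e4, g4⟩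
      · exact absurd (e0.symm.trans e4.symm) e2
      · exfalso
        rw [e0] at g4
        refine n42 (corner_unique hP (v := x 4) (p := e 4) (q := x 2) Y4.fB Y2.fB ?_ ?_ ?_ ?_ ?_)
        · exact g4.1.2.2.2.1
        · simp [g4.mem]
        · simp [g4.mem]
        · simp [g2.mem]
        · simp [g2.mem]
  · rcases G2 with ⟨c2, e2, g2⟩ | ⟨e2, g2⟩
    · rcases G4 with ⟨c4, e4, g4⟩ | ⟨e4, g4⟩
      · exact absurd (e4.symm.trans e2.symm) e0
      · exfalso
        rw [← e2] at g4
        refine n04 (corner_unique hP (v := x 0) (p := e 0) (q := x 2) Y0.fB Y4.fB ?_ ?_ ?_ ?_ ?_)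
        · exact g0.1.2.2.2.1
        · simp [g0.mem]
        · simp [g0.mem]
        · simp [g4.mem]
        · simp [g4.mem]
    · rcases G4 with ⟨c4, e4, g4⟩ | ⟨e4, g4⟩
      · exfalso
        rw [e4] at g2
        refine n20 (corner_unique hP (v := x 2) (p := e 2) (q := x 0) Y2.fB Y0.fB ?_ ?_ ?_ ?_ ?_)
        · exact g2.1.2.2.2.1
        · simp [g2.mem]
        · simp [g2.mem]
        · simp [g0.mem]
        · simp [g0.mem]
      · exfalso
        have a1 : s(x 0, x 2) ∈ T 0 := by simp [g0.mem]
        have a2 : s(x 0, e 0) ∈ T 0 := by simp [g0.mem]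
        have a3 : s(x 2, e 2) ∈ T 0 := by simp [g0.mem]
        have b1 : s(x 2, x 4) ∈ T 2 := by simp [g2.mem]
        have c1 : s(x 0, x 4) ∈ T 4 := by simp [g4.mem]
        have d1 : e 0 ≠ x 2 := g0.1.2.2.2.1
        have d2 : e 0 ≠ x 4 := g4.1.2.2.2.2.2.2.2.2.2.2.2.2.2.1
        have d3 : e 2 ≠ x 4 := g2.1.2.2.2.1
        have d4 : e 2 ≠ x 0 := g0.1.2.2.2.2.2.2.2.2.2.2.2.2.2.1
        obtain ⟨f, hf, f1, f2⟩ := corner_exists hP (face_adj Y0.fB a1) (face_adj Y4.fB c1) e2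
        have hf0 : f ≠ T 0 := by
          rintro rfl
          rcases no_all hP hf a2 f1 f2 with hh | hh | hh
          · exact d1 hh
          · exact d2 hh
          · exact e2 hh
        have hN := nb_of hP (face_adj Y0.fB (sw a1)) (face_adj Y0.fB a3) (face_adj Y2.fB b1)
          d4.symm e4.symm d3
        have f3 := face_step hP hf Y0.fB hf0 hN (sw f1) (sw a1) a3
        exact no3 hP hf f1 f3 (sw f2) e4.symm

lemma case7 (hP : IsFullerene P) (h : RT P R a b e inn T x) (hC : Clar P E H M)
    (hE : ∀ i, R i ⊆ E) (h0 : inn 0 = true)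
    (h1 : inn 1 = false) (h2 : inn 2 = true) (h3 : inn 3 = false) (h4 : inn 4 = true)
    (h5 : inn 5 = false) : False := by
  obtain ⟨e02, e24, c0, c2, c4, g0, g2, g4⟩ := case7_aux hP h h0 h1 h2 h3 h4 h5
  have s1 := h.step (i := 0) (by decide) h1
  have s3 := h.step (i := 2) (by decide) h3
  have s5 := h.step (i := 4) (by decide) h5
  have Y0 := h.yE (j := 5) (i := 0) (by decide) h0
  have Y2 := h.yE (j := 1) (i := 2) (by decide) h2
  have Y4 := h.yE (j := 3) (i := 4) (by decide) h4
  rw [s5] at Y0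
  rw [s1, ← e02] at Y2
  rw [s3, ← e24, ← e02] at Y4
  rw [← e02] at g2
  rw [← e24, ← e02] at g4
  have hz : ∀ i : ZMod 6, i = 0 ∨ i = 1 ∨ i = 2 ∨ i = 3 ∨ i = 4 ∨ i = 5 := by decide
  have hT : ∀ i, T i = T 0 ∨ T i = T 2 ∨ T i = T 4 := by
    intro i
    rcases hz i with rfl | rfl | rfl | rfl | rfl | rfl <;> simp only [s1, s3, s5, true_or, or_true]
  have hT5 : ∀ i, (T i).card = 5 := by
    intro i
    rcases hT i with hh | hh | hh <;> rw [hh] <;> assumption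
  have hx : Yv P (x 0) (e 0) (e 2) (e 4) (T 0) (T 2) (T 4) :=
    ⟨nb_of hP (face_adj Y0.fB (sw Y0.Br)) (face_adj Y2.fB (sw Y2.Br)) (face_adj Y4.fB (sw Y4.Br))
      (h.ne' (by decide)) (h.ne' (by decide)) (h.ne' (by decide)), Y0.fB, Y2.fB, Y4.fB,
      sw Y0.Br, sw Y2.Cr, sw Y2.Br, sw Y4.Cr, sw Y4.Br, sw Y0.Cr⟩
  have nT : ∀ i, T i ∉ H := fun i => hC.notH (hT5 i)
  have nR : ∀ i, R i ∉ H := fun i => hC.notH (h.c5 i)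
  have ux := hC.unc hP hx (nT _) (nT _) (nT _)
  have u0 := hC.unc hP Y0 (nR _) (nT _) (nT _)
  have u2 := hC.unc hP Y2 (nR _) (nT _) (nT _)
  have u4 := hC.unc hP Y4 (nR _) (nT _) (nT _)
  have ua : ∀ i, a i ∉ facesVerts H := fun i => h.uncA hP hC (nT i)
  have yA : ∀ i, Yv P (a i) (b i) (lf a e inn (i - 1) i) (rt a e inn (i + 1)) (R i) (T i)
      (R (i + 1)) := fun i => h.yA (by ring) rfl
  set W : Finset V := insert (e 0) (insert (e 2) (insert (e 4) (Finset.univ.image a))) with hW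
  set KR : Finset (Finset (Sym2 V)) := Finset.univ.image R with hKR
  have hWc : W.card = 9 := by
    rw [hW, Finset.card_insert_of_notMem, Finset.card_insert_of_notMem,
      Finset.card_insert_of_notMem, Finset.card_image_of_injective _ (fun i j hh => h.ainj hh)]
    · rfl
    · simp only [Finset.mem_image, Finset.mem_univ, true_and, not_exists]
      exact fun i => h.ae
    · simp only [Finset.mem_insert, Finset.mem_image, Finset.mem_univ, true_and, not_or,
        not_exists]
      exact ⟨h.ne' (by decide), fun i => h.ae⟩
    · simp only [Finset.mem_insert, Finset.mem_image, Finset.mem_univ, true_and, not_or,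
        not_exists]
      exact ⟨h.ne' (by decide), h.ne' (by decide), fun i => h.ae⟩
  have hKc : KR.card ≤ 6 := Finset.card_image_le
  have hRK : ∀ i, R i ∈ KR := fun i => by simp [hKR]
  have hWmem : ∀ u ∈ W, u ∈ edgeVerts E ∧ u ∉ facesVerts H ∧
      ∀ f ∈ P.faces, u ∈ edgeVerts f → f ∈ KR ∨ f = T 0 ∨ f = T 2 ∨ f = T 4 := by
    intro u hu
    simp only [hW, Finset.mem_insert, Finset.mem_image, Finset.mem_univ, true_and] at hu
    rcases hu with rfl | rfl | rfl | ⟨i, rfl⟩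
    · refine ⟨mem_edgeVerts.2 ⟨_, hE _ Y0.Ap⟩, u0, fun f hf hf' => ?_⟩
      rcases Y0.face hP hf hf' with hh | hh | hh <;> simp [hh, hRK]
    · refine ⟨mem_edgeVerts.2 ⟨_, hE _ Y2.Ap⟩, u2, fun f hf hf' => ?_⟩
      rcases Y2.face hP hf hf' with hh | hh | hh <;> simp [hh, hRK]
    · refine ⟨mem_edgeVerts.2 ⟨_, hE _ Y4.Ap⟩, u4, fun f hf hf' => ?_⟩
      rcases Y4.face hP hf hf' with hh | hh | hh <;> simp [hh, hRK]
    · refine ⟨mem_edgeVerts.2 ⟨_, hE _ (yA i).Ap⟩, ua i, fun f hf hf' => ?_⟩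
      rcases (yA i).face hP hf hf' with hh | hh | hh
      · simp [hh, hRK]
      · rw [hh]; exact Or.inr (hT i)
      · simp [hh, hRK]
  by_cases hxE : x 0 ∈ edgeVerts E
  · set K : Finset (Finset (Sym2 V)) := insert (T 0) (insert (T 2) (insert (T 4) KR)) with hK
    have hKc' : K.card ≤ 9 := by
      have k1 := Finset.card_insert_le (T 0) (insert (T 2) (insert (T 4) KR))
      have k2 := Finset.card_insert_le (T 2) (insert (T 4) KR)
      have k3 := Finset.card_insert_le (T 4) KR
      rw [hK]
      omega
    have hxW : x 0 ∉ W := by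
      simp only [hW, Finset.mem_insert, Finset.mem_image, Finset.mem_univ, true_and, not_or,
        not_exists]
      have v0 := hx.nb
      refine ⟨?_, ?_, ?_, ?_⟩
      · exact g0.1.2.2.2.1.symm
      · exact g2.1.2.2.2.1.symm
      · exact g4.1.2.2.2.1.symm
      · intro i
        rcases hz i with rfl | rfl | rfl | rfl | rfl | rfl
        · exact g0.1.2.2.2.2.2.2.1
        · exact g0.1.2.2.2.2.2.2.2.2.1
        · exact g2.1.2.2.2.2.2.2.1
        · exact g2.1.2.2.2.2.2.2.2.2.1
        · exact g4.1.2.2.2.2.2.2.1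
        · exact g4.1.2.2.2.2.2.2.2.2.1
    have hF : ∀ u ∈ insert (x 0) W, ∃ p ∈ K, Lv P E H M p u := by
      intro u hu
      rcases Finset.mem_insert.1 hu with rfl | hu
      · obtain ⟨p, hp⟩ := hC.F1 hxE ux
        refine ⟨p, ?_, hp⟩
        rcases hx.face hP hp.1 hp.2.2.2.1 with hh | hh | hh <;> simp [hK, hh]
      · obtain ⟨k1, k2, k3⟩ := hWmem u hu
        obtain ⟨p, hp⟩ := hC.F1 k1 k2
        refine ⟨p, ?_, hp⟩
        rcases k3 p hp.1 hp.2.2.2.1 with hh | hh | hh | hh <;> simp [hK, hh]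
    choose! φ hφ1 hφ2 using hF
    obtain ⟨u, hu, v, hv, huv, hh⟩ := Finset.exists_ne_map_eq_of_card_lt_of_maps_to
      (s := insert (x 0) W) (t := K) (by rw [Finset.card_insert_of_notMem hxW]; omega) hφ1
    exact huv (hC.F2 (hφ2 u hu) (hh ▸ hφ2 v hv))
  · have hF : ∀ u ∈ W, ∃ p ∈ KR, Lv P E H M p u := by
      intro u hu
      obtain ⟨k1, k2, k3⟩ := hWmem u hu
      obtain ⟨p, hp⟩ := hC.F1 k1 k2
      refine ⟨p, ?_, hp⟩
      rcases k3 p hp.1 hp.2.2.2.1 with hh | hh | hh | hh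
      · exact hh
      · subst hh; exact absurd (mem_edgeVerts.2 ⟨_, hp.2.2.1 hx.Ap⟩) hxE
      · subst hh; exact absurd (mem_edgeVerts.2 ⟨_, hp.2.2.1 hx.Bq⟩) hxE
      · subst hh; exact absurd (mem_edgeVerts.2 ⟨_, hp.2.2.1 hx.Cr⟩) hxE
    choose! φ hφ1 hφ2 using hF
    obtain ⟨u, hu, v, hv, huv, hh⟩ := Finset.exists_ne_map_eq_of_card_lt_of_maps_to
      (s := W) (t := KR) (by omega) hφ1
    exact huv (hC.F2 (hφ2 u hu) (hh ▸ hφ2 v hv))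

end shapes2

set_option linter.unusedSectionVars false

/-! ### The shape without inner pentagon corners -/

section shapes3

variable {P : PlaneGraph V} {R : ZMod 6 → Finset (Sym2 V)} {a b e : ZMod 6 → V}
  {inn : ZMod 6 → Bool} {T : ZMod 6 → Finset (Sym2 V)} {x : ZMod 6 → V}
  {E : Finset (Sym2 V)} {H : Finset (Finset (Sym2 V))} {M : Finset (Sym2 V)}

lemma RT.starA (h : RT P R a b e inn T x) (ht : ∀ i, inn i = true) (i : ZMod 6) :
    Yv P (a i) (b i) (e i) (e (i + 1)) (R i) (T i) (R (i + 1)) := by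
  have := h.yA (j := i - 1) (i := i) (k := i + 1) (by ring) rfl
  simpa only [lf, rt, ht, if_true] using this

lemma RT.starE (h : RT P R a b e inn T x) (ht : ∀ i, inn i = true) (i : ZMod 6) :
    Yv P (e (i + 1)) (a i) (a (i + 1)) (x (i + 1)) (R (i + 1)) (T (i + 1)) (T i) :=
  h.yE rfl (ht _)

lemma zmod_down {p : ZMod 6 → Prop} {i : ZMod 6} (hi : p i) (h : ∀ j, p (j + 1) → p j)
    (k : ZMod 6) : p k := by
  have hn : ∀ n : ℕ, p (i - n) := by
    intro n
    induction n with
    | zero => simpa using hi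
    | succ n ih =>
      refine h _ ?_
      have : i - ((n + 1 : ℕ) : ZMod 6) + 1 = i - n := by push_cast; ring
      rwa [this]
  have := hn (i - k).val
  rwa [ZMod.natCast_zmod_val, sub_sub_cancel] at this

lemma zmod_up {p : ZMod 6 → Prop} {i : ZMod 6} (hi : p i) (h : ∀ j, p j → p (j + 1))
    (k : ZMod 6) : p k := by
  have := zmod_down (p := fun j => p (-j)) (i := -i) (by simpa using hi) (fun j hj => by
    have := h _ hj
    have h2 : -(j + 1) + 1 = -j := by ring
    rwa [h2] at this) (-k)
  simpa using this

lemma star_pent (hP : IsFullerene P) (h : RT P R a b e inn T x) (hC : Clar P E H M)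
    (hE : ∀ i, R i ⊆ E) (ht : ∀ i, inn i = true) (hb : ∀ i, b i ∈ facesVerts H) (k : ZMod 6) :
    (T k).card = 5 := by
  have tri : ∀ i, T i ∉ H → s(a i, e i) ∈ M ∨ s(a i, e (i + 1)) ∈ M := by
    intro i hi
    have Y := h.starA ht i
    rcases hC.tricho hP Y (h.uncA hP hC hi) (hE _ Y.Ap) (hE _ Y.Aq) (hE _ Y.Cr) with
      ⟨m, -⟩ | ⟨m, -⟩ | ⟨m, -⟩
    · exact absurd (hb i) (hC.mC (sw m))
    · exact Or.inl m
    · exact Or.inr m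
  have n1 : ∀ i : ZMod 6, i + 1 ≠ i := by decide
  have dn : ∀ j, s(a (j + 1), e (j + 1)) ∈ M → (T j).card = 5 ∧ s(a j, e j) ∈ M := by
    intro j m
    have l := hC.leave hP (h.starE ht j).rot (sw m)
    refine ⟨l.2.1, ?_⟩
    rcases tri j (hC.notH l.2.1) with m' | m'
    · exact m'
    · exact absurd (hC.mU (sw m) (sw m')) (h.na (n1 j))
  have up : ∀ j, s(a j, e (j + 1)) ∈ M →
      (T (j + 1)).card = 5 ∧ s(a (j + 1), e (j + 1 + 1)) ∈ M := by
    intro j m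
    have l := hC.leave hP (h.starE ht j) (sw m)
    refine ⟨l.2.1, ?_⟩
    rcases tri (j + 1) (hC.notH l.2.1) with m' | m'
    · exact absurd (hC.mU (sw m') (sw m)) (h.na (n1 j))
    · exact m'
  have hex : ∃ i, T i ∉ H := by
    by_contra hcon
    push Not at hcon
    have Y := h.starE ht 0
    exact Y.rot.neAB hP (hC.disj (hcon (0 + 1)) (hcon 0) (mem_edgeVerts.2 ⟨_, Y.Bq⟩)
      (mem_edgeVerts.2 ⟨_, Y.Cp⟩))
  obtain ⟨i, hi⟩ := hex
  rcases tri i hi with m | m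
  · exact (dn k (zmod_down (p := fun j => s(a j, e j) ∈ M) m (fun j hj => (dn j hj).2) _)).1
  · have := (up (k - 1)
      (zmod_up (p := fun j => s(a j, e (j + 1)) ∈ M) m (fun j hj => (up j hj).2) _)).1
    rwa [sub_add_cancel] at this

lemma star_cyc (hP : IsFullerene P) (h : RT P R a b e inn T x) (ht : ∀ i, inn i = true)
    (h5 : ∀ i, (T i).card = 5) (i : ZMod 6) :
    Cyc5 (T i) (e i) (a i) (e (i + 1)) (x (i + 1)) (x i) := by
  have Y := h.starA ht i
  have YE := h.yE (j := i - 1) (i := i) (by ring) (ht i)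
  have YF := h.starE ht i
  rcases path3 hP Y.fB (sw Y.Bq) Y.Br Y.nb.2.2.1 with ⟨c, y, z, hc⟩ | ⟨c, -⟩
  · have m1 : s(e i, z) ∈ T i := by simp [hc.mem]
    have m2 : s(e (i + 1), y) ∈ T i := by simp [hc.mem]
    have hz : z = x i := by
      rcases YE.memB hP m1 with hh | hh
      · exact absurd hh.symm hc.1.2.2.2.2.2.2.1
      · exact hh
    have hy : y = x (i + 1) := by
      rcases YF.rot.memB hP m2 with hh | hh
      · exact hh
      · exact absurd hh.symm hc.1.2.2.2.2.2.1
    rw [hz, hy] at hc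
    exact hc
  · have := h5 i
    omega

lemma star_card (hP : IsFullerene P) (h : RT P R a b e inn T x) (ht : ∀ i, inn i = true)
    (h5 : ∀ i, (T i).card = 5) : Fintype.card V = 24 := by
  have hc := star_cyc hP h ht h5
  have na : ∀ i, Nb P (a i) (b i) (e i) (e (i + 1)) := fun i => (h.starA ht i).nb
  have ne : ∀ i, Nb P (e (i + 1)) (a i) (a (i + 1)) (x (i + 1)) := fun i => (h.starE ht i).nb
  have nb : ∀ i, Nb P (b i) (a i) (b (i - 1)) (b (i + 1)) := by
    intro i
    have := h.toRD.comp.nbA hP (j := i - 1) (i := i) (k := i + 1) (by ring) rfl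
    simpa [lf, rt, ht] using this
  have nx : ∀ i, Nb P (x (i + 1)) (e (i + 1)) (x i) (x (i + 1 + 1)) := by
    intro i
    have c1 := hc i
    have c2 := hc (i + 1)
    have m1 : s(x (i + 1), e (i + 1)) ∈ T i := by simp [c1.mem]
    have m2 : s(x (i + 1), x i) ∈ T i := by simp [c1.mem]
    have m3 : s(x (i + 1), e (i + 1)) ∈ T (i + 1) := by simp [c2.mem]
    have m4 : s(x (i + 1), x (i + 1 + 1)) ∈ T (i + 1) := by simp [c2.mem]
    have Y := h.starE ht i
    refine nb_of hP (face_adj Y.fB m3) (face_adj Y.fC m2) (face_adj Y.fB m4) ?_ ?_ ?_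
    · exact c1.1.2.2.2.2.2.2.2.2.1
    · exact c2.1.2.2.1
    · intro hh
      rw [← hh] at m4
      exact Y.rot.neAB hP (corner_unique hP Y.fB Y.fC c1.1.2.2.2.2.2.2.2.2.1 m3 m4 m1 m2)
  have sb : ∀ i : ZMod 6, ∃ j, i = j + 1 := fun i => ⟨i - 1, by ring⟩
  have xa : ∀ i m, x i ≠ a m := by
    intro i m hh
    obtain ⟨j, rfl⟩ := sb i
    have hadj : P.graph.Adj (e (j + 1)) (a m) := ((ne j).2.2.2 _).2 (by simp [← hh])
    rcases ((na m).2.2.2 _).1 hadj.symm with h1 | h1 | h1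
    · exact h.be h1.symm
    · rw [← h.einj h1] at hh
      exact (ne j).2.2.1 hh.symm
    · have := h.einj h1
      rw [← add_right_cancel this] at hh
      exact (ne j).2.1 hh.symm
  have xb : ∀ i m, x i ≠ b m := by
    intro i m hh
    obtain ⟨j, rfl⟩ := sb i
    have hadj : P.graph.Adj (e (j + 1)) (b m) := ((ne j).2.2.2 _).2 (by simp [← hh])
    rcases ((nb m).2.2.2 _).1 hadj.symm with h1 | h1 | h1
    · exact h.ae h1.symm
    · exact h.be h1.symm
    · exact h.be h1.symm
  have xe : ∀ i m, x i ≠ e m := by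
    intro i m hh
    obtain ⟨j, rfl⟩ := sb i
    obtain ⟨k, rfl⟩ := sb m
    have h1 : P.graph.Adj (e (k + 1)) (e (j + 1)) := by
      rw [← hh]; exact ((nx j).2.2.2 _).2 (Or.inl rfl)
    have hxk : e (j + 1) = x (k + 1) := by
      rcases ((ne k).2.2.2 _).1 h1 with h2 | h2 | h2
      · exact absurd h2.symm h.ae
      · exact absurd h2.symm h.ae
      · exact h2
    have h3 : P.graph.Adj (e (k + 1)) (x (j + 1 + 1)) := by
      rw [← hh]; exact ((nx j).2.2.2 _).2 (Or.inr (Or.inr rfl))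
    rcases ((ne k).2.2.2 _).1 h3 with h2 | h2 | h2
    · exact xa _ _ h2
    · exact xa _ _ h2
    · rw [← hxk] at h2
      exact (hc (j + 1)).1.2.2.1 h2.symm
  have xinj : ∀ i m, x i = x m → i = m := by
    intro i m hh
    obtain ⟨j, rfl⟩ := sb i
    obtain ⟨k, rfl⟩ := sb m
    have h1 : P.graph.Adj (x (j + 1)) (e (k + 1)) := by
      rw [hh]; exact ((nx k).2.2.2 _).2 (Or.inl rfl)
    rcases ((nx j).2.2.2 _).1 h1 with h2 | h2 | h2
    · exact (h.einj h2).symm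
    · exact absurd h2.symm (xe _ _)
    · exact absurd h2.symm (xe _ _)
  let φ : (ZMod 6 ⊕ ZMod 6) ⊕ (ZMod 6 ⊕ ZMod 6) → V := Sum.elim (Sum.elim a b) (Sum.elim e x)
  have hinj : Function.Injective φ := by
    refine Function.Injective.sumElim (Function.Injective.sumElim (fun i j => h.ainj)
      (fun i j => h.binj) (fun i j => h.ab)) (Function.Injective.sumElim (fun i j => h.einj)
      (fun i j => xinj i j) (fun i j => (xe j i).symm)) ?_
    rintro (i | i) (j | j)
    · exact h.ae
    · exact (xa j i).symm
    · exact h.be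
    · exact (xb j i).symm
  let S : Set V := Set.range φ
  have Sa : ∀ i, a i ∈ S := fun i => ⟨Sum.inl (Sum.inl i), rfl⟩
  have Sb : ∀ i, b i ∈ S := fun i => ⟨Sum.inl (Sum.inr i), rfl⟩
  have Se : ∀ i, e i ∈ S := fun i => ⟨Sum.inr (Sum.inl i), rfl⟩
  have Sx : ∀ i, x i ∈ S := fun i => ⟨Sum.inr (Sum.inr i), rfl⟩
  have hcl : ∀ u v, P.graph.Adj u v → u ∈ S → v ∈ S := by
    rintro u v huv ⟨(i | i) | (i | i), rfl⟩
    · rcases ((na i).2.2.2 _).1 huv with rfl | rfl | rfl <;> simp only [Sa, Sb, Se, Sx]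
    · rcases ((nb i).2.2.2 _).1 huv with rfl | rfl | rfl <;> simp only [Sa, Sb, Se, Sx]
    · obtain ⟨j, rfl⟩ := sb i
      rcases ((ne j).2.2.2 _).1 huv with rfl | rfl | rfl <;> simp only [Sa, Sb, Se, Sx]
    · obtain ⟨j, rfl⟩ := sb i
      rcases ((nx j).2.2.2 _).1 huv with rfl | rfl | rfl <;> simp only [Sa, Sb, Se, Sx]
  have hsurj : Function.Surjective φ := by
    intro v
    have := const_of_adj hP (fun u => u ∈ S)
      (fun u v huv => propext ⟨hcl u v huv, hcl v u huv.symm⟩) (a 0) v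
    exact this.mp (Sa 0)
  rw [← Fintype.card_of_bijective ⟨hinj, hsurj⟩]
  simp [ZMod.card]

lemma case0 (hP : IsFullerene P) (h : RT P R a b e inn T x) (hC : Clar P E H M)
    (hE : ∀ i, R i ⊆ E) (hn : Fintype.card V ≠ 24) (ht : ∀ i, inn i = false) : False := by
  have sT : ∀ i, T i = T 0 := fun i =>
    zmod_up (p := fun j => T j = T 0) (i := 0) rfl
      (fun j hj => (h.step rfl (ht _)).trans hj) i
  have Y : ∀ j i k, i = j + 1 → k = i + 1 → Yv P (a i) (b i) (a j) (a k) (R i) (T 0) (R k) := by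
    intro j i k h1 h2
    have := h.yA h1 h2
    rw [sT] at this
    simpa only [lf, rt, ht, Bool.false_eq_true, if_false] using this
  by_cases h0 : T 0 ∈ H
  · obtain ⟨Q, y, hQ⟩ := h.toRD.comp.exists_rt hP
    have hb : ∀ i, a i ∈ facesVerts H := fun i =>
      mem_facesVerts.2 ⟨_, h0, mem_edgeVerts.2 ⟨_, (Y (i - 1) i (i + 1) (by ring) rfl).Bq⟩⟩
    have ht' : ∀ i, (!(inn i)) = true := fun i => by rw [ht]; rfl
    exact hn (star_card hP hQ ht' (star_pent hP hQ hC hE ht' hb))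
  · have m : ∀ i, s(a i, a (i + 1)) ∈ T 0 := fun i => (Y (i - 1) i (i + 1) (by ring) rfl).Br
    have c6 := (path6 hP (Y 5 0 1 (by decide) (by decide)).fB (m 0) (m 1) (m 2) (m 3) (m 4)
      (h.na (by decide)) (h.na (by decide)) (h.na (by decide)) (h.na (by decide))
      (h.na (by decide))).1
    have tri : ∀ j i k, i = j + 1 → k = i + 1 →
        (s(a i, a j) ∈ M ∧ Lv P E H M (R k) (a i)) ∨
        (s(a i, a k) ∈ M ∧ Lv P E H M (R i) (a i)) := by
      intro j i k h1 h2
      have YY := Y j i k h1 h2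
      rcases hC.tricho hP YY (h.uncA hP hC (by rwa [sT])) (hE _ YY.Ap) (hE _ YY.Aq)
        (hE _ YY.Cr) with ⟨-, l⟩ | hh | hh
      · have := l.2.1
        omega
      · exact Or.inl hh
      · exact Or.inr hh
    have A0 := tri 5 0 1 (by decide) (by decide)
    have A1 := tri 0 1 2 (by decide) (by decide)
    have A2 := tri 1 2 3 (by decide) (by decide)
    rcases A1 with ⟨m1, l1⟩ | ⟨m1, l1⟩
    · rcases A2 with ⟨m2, l2⟩ | ⟨m2, l2⟩
      · exact absurd (hC.mU m1 (sw m2)) (h.na (by decide))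
      · exact absurd (hC.F2 l1 l2) (h.na (by decide))
    · rcases A0 with ⟨m2, l2⟩ | ⟨m2, l2⟩
      · exact absurd (hC.F2 l1 l2) (h.na (by decide))
      · exact absurd (hC.mU m1 (sw m2)) (h.na (by decide))

lemma main_aux (hP : IsFullerene P) (hn : Fintype.card V ≠ 24)
    (hE : ∀ e ∈ E, e ∈ P.graph.edgeSet) (hR : IsPentRing P 6 R) (hsub : ∀ i, R i ⊆ E) :
    ¬IsExtremalSub P E := by
  intro hext
  obtain ⟨H, M, hC⟩ := exists_clar hP hE hext
  obtain ⟨a', b', e', inn', h'⟩ := exists_rd hP hR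
  obtain ⟨R, a, b, e, inn, hd, hs, hcan⟩ := h'.canonical hsub
  obtain ⟨T, x, h⟩ := hd.exists_rt hP
  have hz : ∀ i : ZMod 6, i = 0 ∨ i = 1 ∨ i = 2 ∨ i = 3 ∨ i = 4 ∨ i = 5 := by decide
  simp only [canon, List.mem_cons, Prod.mk.injEq, List.not_mem_nil, or_false,
    decide_eq_true_eq] at hcan
  rcases hcan with hh | hh | hh | hh | hh | hh | hh | hh <;>
    obtain ⟨h0, h1, h2, h3, h4, h5⟩ := hh
  · refine case0 hP h hC hs hn fun i => ?_
    rcases hz i with rfl | rfl | rfl | rfl | rfl | rfl <;> assumption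
  · exact case1 hP h h0 h1 h2 h3 h4 h5
  · exact case2 hP h h0 h1 h2 h3 h4 h5
  · exact case3 hP h h0 h1 h2 h3 h4 h5
  · exact case4 hP h hC hs h0 h1 h2 h3 h4 h5
  · exact case5 hP h h0 h1 h2 h3 h4 h5
  · exact case6 hP h h0 h1 h2 h3 h4 h5
  · exact case7 hP h hC hs h0 h1 h2 h3 h4 h5

end shapes3

/-- Observation 3. Let `G` be a subgraph of a fullerene graph `F_n`
with `n ≠ 24`. If `R_6 ⊆ G`, then `G` is not extremal. -/
theorem statement_7 (P : PlaneGraph V) (hP : IsFullerene P)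
    (hn : Fintype.card V ≠ 24) (E : Finset (Sym2 V))
    (hE : ∀ e ∈ E, e ∈ P.graph.edgeSet)
    (R : ZMod 6 → Finset (Sym2 V)) (hR : IsPentRing P 6 R) (hsub : ∀ i, R i ⊆ E) :
    ¬IsExtremalSub P E := by
  exact main_aux hP hn hE hR hsub

end FG
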